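/- arXiv:2011.09428 — 8 statements merged into one kernel-verified Lean document; each statement's English description precedes it below -/
import Mathlib

section
/- Maker has a winning strategy in the Maker-Breaker K^{ℵ₀}-building game on the countably infinite complete graph: there exists a valid Maker strategy σ such that in every play (with Maker moving first) that follows σ, there is an infinite set W ⊆ ℕ all of whose edges (unordered pairs of distinct elements of W) are among Maker's claimed edges. -/
/-- The board: edges of the complete graph on ℕ, i.e. unordered pairs of
distinct natural numbers. -/
abbrev Edge := {e : Sym2 ℕ // ¬ e.IsDiag}

/-- The interleaved sequence of moves M 0, B 0, M 1, B 1, … . -/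
def interleave (M B : ℕ → Edge) (n : ℕ) : Edge :=
  if n % 2 = 0 then M (n / 2) else B (n / 2)

/-- A play of the game: all the moves M 0, B 0, M 1, B 1, … are pairwise distinct. -/
def IsPlay (M B : ℕ → Edge) : Prop :=
  Function.Injective (interleave M B)

/-- The history M 0, B 0, …, M (n-1), B (n-1) seen by Maker before her n-th move. -/
def histM (M B : ℕ → Edge) : ℕ → List Edge
  | 0 => []
  | n + 1 => histM M B n ++ [M n, B n]

/-- The history M 0, B 0, …, M n seen by Breaker before his n-th move. -/
def histB (M B : ℕ → Edge) (n : ℕ) : List Edge :=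
  histM M B n ++ [M n]

/-- A strategy is valid if it never names an already claimed edge. -/
def ValidStrat (σ : List Edge → Edge) : Prop :=
  ∀ h, σ h ∉ h

/-- The play (M, B) follows the Maker strategy σ. -/
def FollowsMaker (σ : List Edge → Edge) (M B : ℕ → Edge) : Prop :=
  ∀ n, M n = σ (histM M B n)

/-- Every edge with both endpoints in W is among Maker's claimed edges. -/
def BuildsClique (M : ℕ → Edge) (W : Set ℕ) : Prop :=
  ∀ u ∈ W, ∀ v ∈ W, u ≠ v → ∃ n, (M n : Sym2 ℕ) = s(u, v)

namespace KGame
open Classical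

structure St where
  P : Finset (List ℕ)
  x : ℕ
  l : List ℕ

def OKc (P : Finset (List ℕ)) (x : ℕ) (l : List ℕ) (h : List Edge) (c : ℕ) : Prop :=
  c :: l ∈ P ∧ ∃ e : Edge, e.1 = s(x, c) ∧ e ∉ h

def Avail (P : Finset (List ℕ)) (x : ℕ) (l : List ℕ) (h : List Edge) : Prop :=
  ∃ c, OKc P x l h c

noncomputable def mv (s : St) (h : List Edge) : ℕ :=
  if H : Avail s.P s.x s.l h then H.choose else 0

lemma mv_spec {s : St} {h : List Edge} (H : Avail s.P s.x s.l h) :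
    OKc s.P s.x s.l h (mv s h) := by
  unfold mv
  rw [dif_pos H]
  exact H.choose_spec

lemma exists_fresh (P : Finset (List ℕ)) (h : List Edge) :
    ∃ x : ℕ, (∀ e ∈ h, x ∉ e.1) ∧ ∀ p ∈ P, x ∉ p := by
  have h1 : (⋃ e ∈ {e | e ∈ h}, {x : ℕ | x ∈ e.1}).Finite := by
    apply Set.Finite.biUnion (List.finite_toSet h)
    rintro ⟨e, he⟩ -
    induction e with
    | _ a b =>
      apply (Set.toFinite ({a, b} : Set ℕ)).subset
      intro x hx
      simpa using hx
  have h2 : (⋃ p ∈ (P : Set (List ℕ)), {x : ℕ | x ∈ p}).Finite := by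
    apply Set.Finite.biUnion P.finite_toSet
    intro p _
    exact List.finite_toSet p
  obtain ⟨x, hx⟩ := (h1.union h2).infinite_compl.nonempty
  simp only [Set.mem_compl_iff, Set.mem_union, Set.mem_iUnion, not_or, not_exists] at hx
  exact ⟨x, fun e he hxe => hx.1 e he hxe, fun p hp hxp => hx.2 p hp hxp⟩

noncomputable def fresh (P : Finset (List ℕ)) (h : List Edge) : ℕ := (exists_fresh P h).choose

lemma fresh_spec (P : Finset (List ℕ)) (h : List Edge) :
    (∀ e ∈ h, fresh P h ∉ e.1) ∧ ∀ p ∈ P, fresh P h ∉ p := (exists_fresh P h).choose_spec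

noncomputable def upd (s : St) (h h' : List Edge) : St :=
  if Avail s.P s.x (mv s h :: s.l) h' then ⟨s.P, s.x, mv s h :: s.l⟩
  else ⟨insert (s.x :: mv s h :: s.l) s.P,
    fresh (insert (s.x :: mv s h :: s.l) s.P) h', []⟩

def init : St := ⟨{[], [0]}, 1, []⟩

noncomputable def run (h : List Edge) : St :=
  if h.length < 2 then init
  else upd (run (h.take (h.length - 2))) (h.take (h.length - 2)) h
termination_by h.length
decreasing_by simp; omega

lemma exists_edge (h : List Edge) : ∃ e : Edge, e ∉ h := by
  obtain ⟨x, hx, hp⟩ := exists_fresh {[0]} h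
  have : x ≠ 0 := by simpa using hp
  refine ⟨⟨s(x, 0), by simpa using this⟩, fun he => hx _ he (by simp)⟩

noncomputable def strat (h : List Edge) : Edge :=
  if H : ∃ e : Edge, e.1 = s((run h).x, mv (run h) h) ∧ e ∉ h then H.choose
  else (exists_edge h).choose

lemma strat_valid : ValidStrat strat := by
  intro h
  unfold strat
  split_ifs with H
  · exact H.choose_spec.2
  · exact (exists_edge h).choose_spec

lemma strat_spec {h : List Edge} (H : Avail (run h).P (run h).x (run h).l h) :
    (strat h).1 = s((run h).x, mv (run h) h) := by
  have H' := (mv_spec H).2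
  unfold strat
  rw [dif_pos H']
  exact H'.choose_spec.1

lemma histM_length (M B : ℕ → Edge) (n : ℕ) : (histM M B n).length = 2 * n := by
  induction n with
  | zero => rfl
  | succ n ih => simp [histM, ih]; omega

lemma run_zero (M B : ℕ → Edge) : run (histM M B 0) = init := by
  rw [run]; simp [histM]

lemma run_succ (M B : ℕ → Edge) (n : ℕ) :
    run (histM M B (n+1)) = upd (run (histM M B n)) (histM M B n) (histM M B (n+1)) := by
  have h1 := histM_length M B (n+1)
  have h2 := histM_length M B n
  have h3 : (histM M B (n+1)).take ((histM M B (n+1)).length - 2) = histM M B n := by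
    rw [h1]
    show (histM M B n ++ [M n, B n]).take _ = _
    apply List.take_left'
    omega
  conv_lhs => rw [run]
  rw [if_neg (by omega), h3]

def ME (M : ℕ → Edge) (u v : ℕ) : Prop := ∃ n, (M n : Sym2 ℕ) = s(u, v)

structure Inv (M : ℕ → Edge) (s : St) (h : List Edge) : Prop where
  nil : [] ∈ s.P
  zero : [0] ∈ s.P
  cur : s.l ∈ s.P
  notin : ∀ p ∈ s.P, s.x ∉ p
  av : Avail s.P s.x s.l h
  nodup : ∀ p ∈ s.P, p.Nodup
  pw : ∀ p ∈ s.P, p.Pairwise (ME M)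
  adj : ∀ a ∈ s.l, ME M s.x a
  tl : ∀ c p, c :: p ∈ s.P → p ∈ s.P
  cnt : (h.filter (fun e => s.x ∈ e.1)).length ≤ 2 * s.l.length
  br : ∀ p, ∀ F : Finset ℕ, (∀ c ∈ F, c :: p ∈ s.P) → F.card ≤ 2 * p.length + 1

lemma avail_of_fresh {P : Finset (List ℕ)} {x : ℕ} {h : List Edge} (h0 : [0] ∈ P)
    (hx : ∀ e ∈ h, x ∉ e.1) (hp : ∀ p ∈ P, x ∉ p) : Avail P x [] h := by
  have : x ≠ 0 := by simpa using hp _ h0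
  exact ⟨0, h0, ⟨s(x, 0), by simpa using this⟩, rfl, fun he => hx _ he (by simp)⟩

lemma inv_init (M : ℕ → Edge) : Inv M init [] where
  nil := by simp [init]
  zero := by simp [init]
  cur := by simp [init]
  notin := by simp [init]
  av := avail_of_fresh (by simp [init]) (by simp) (by simp [init])
  nodup := by simp [init]
  pw := by simp [init]
  adj := by simp [init]
  tl := by simp [init]
  cnt := by simp
  br := by
    intro p F hF
    have : F ⊆ {0} := by
      intro c hc
      have := hF c hc
      simp [init] at this
      simp [this.1]
    have := Finset.card_le_card this
    simp at this
    omega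

lemma inv_upd {M : ℕ → Edge} {s : St} {h : List Edge} (I : Inv M s h) (m b : Edge)
    (hm : ME M s.x (mv s h)) : Inv M (upd s h (h ++ [m, b])) (h ++ [m, b]) := by
  obtain ⟨hc, -⟩ := mv_spec I.av
  have hadj : ∀ a ∈ mv s h :: s.l, ME M s.x a := by
    intro a ha
    rcases List.mem_cons.1 ha with rfl | ha
    · exact hm
    · exact I.adj a ha
  have hcnt : ((h ++ [m, b]).filter (fun e => s.x ∈ e.1)).length
      ≤ 2 * (mv s h :: s.l).length := by
    have h1 := I.cnt
    have h2 := List.length_filter_le (fun e : Edge => decide (s.x ∈ e.1)) [m, b]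
    rw [List.filter_append, List.length_append]
    simp only [List.length_cons, List.length_nil] at h2 ⊢
    omega
  unfold upd
  generalize mv s h = c at *
  split_ifs with H
  · exact ⟨I.nil, I.zero, hc, I.notin, H, I.nodup, I.pw, hadj, I.tl, hcnt, I.br⟩
  · have hz : [0] ∈ insert (s.x :: c :: s.l) s.P := Finset.mem_insert_of_mem I.zero
    obtain ⟨f1, f2⟩ := fresh_spec (insert (s.x :: c :: s.l) s.P) (h ++ [m, b])
    refine ⟨Finset.mem_insert_of_mem I.nil, hz, Finset.mem_insert_of_mem I.nil, f2,
      avail_of_fresh hz f1 f2, ?_, ?_, by simp, ?_, ?_, ?_⟩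
    · intro p hp
      rcases Finset.mem_insert.1 hp with rfl | hp
      · exact List.nodup_cons.2 ⟨I.notin _ hc, I.nodup _ hc⟩
      · exact I.nodup _ hp
    · intro p hp
      rcases Finset.mem_insert.1 hp with rfl | hp
      · exact List.pairwise_cons.2 ⟨hadj, I.pw _ hc⟩
      · exact I.pw _ hp
    · intro d p hp
      rcases Finset.mem_insert.1 hp with hp | hp
      · obtain ⟨-, rfl⟩ := List.cons.inj hp
        exact Finset.mem_insert_of_mem hc
      · exact Finset.mem_insert_of_mem (I.tl _ _ hp)
    · rw [List.filter_eq_nil_iff.2]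
      · simp
      · intro e he
        simpa using f1 e he
    · intro p F hF
      by_cases hp : p = c :: s.l
      · subst hp
        have hF' : ∀ d ∈ F.erase s.x, d :: c :: s.l ∈ s.P := by
          intro d hd
          rw [Finset.mem_erase] at hd
          rcases Finset.mem_insert.1 (hF d hd.2) with h1 | h1
          · exact absurd (List.cons.inj h1).1 hd.1
          · exact h1
        have h2 : (F.erase s.x).card ≤
            (((h ++ [m, b]).filter (fun e => s.x ∈ e.1)).map Subtype.val).toFinset.card := by
          apply Finset.card_le_card_of_injOn (fun d => s(s.x, d))
          · intro d hd
            have hne : s.x ≠ d := fun hh => (Finset.mem_erase.1 hd).1 hh.symm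
            have : (⟨s(s.x, d), by simpa using hne⟩ : Edge) ∈ h ++ [m, b] := by
              by_contra hcon
              exact H ⟨d, hF' d hd, _, rfl, hcon⟩
            simp only [Finset.mem_coe, List.mem_toFinset, List.mem_map, List.mem_filter]
            exact ⟨_, ⟨this, by simp⟩, rfl⟩
          · intro a _ b _ hab
            rcases Sym2.eq_iff.1 hab with h5 | h5
            · exact h5.2
            · exact h5.2.trans h5.1
        have h3 := List.toFinset_card_le
          (((h ++ [m, b]).filter (fun e => s.x ∈ e.1)).map Subtype.val)
        rw [List.length_map] at h3
        have h4 := Finset.pred_card_le_card_erase (s := F) (a := s.x)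
        omega
      · apply I.br p F
        intro d hd
        rcases Finset.mem_insert.1 (hF d hd) with h1 | h1
        · exact absurd (List.cons.inj h1).2 hp
        · exact h1

lemma upd_pot (s : St) (h h' : List Edge) (L : ℕ) (hn : ∀ p ∈ s.P, s.x ∉ p)
    (hL : s.l.length ≤ L) :
    (L+1) * s.P.card + s.l.length + 1 ≤ (L+1) * (upd s h h').P.card + (upd s h h').l.length := by
  unfold upd
  split_ifs with H
  · simp only [List.length_cons]; omega
  · simp only []
    rw [Finset.card_insert_of_notMem (fun hh => hn _ hh (by simp))]
    simp only [List.length_nil]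
    rw [Nat.mul_add]; omega

lemma upd_mono (s : St) (h h' : List Edge) : s.P ⊆ (upd s h h').P := by
  unfold upd
  split_ifs with H
  · simp
  · exact Finset.subset_insert _ _

theorem main (M B : ℕ → Edge) (hf : FollowsMaker strat M B) :
    ∃ W : Set ℕ, W.Infinite ∧ BuildsClique M W := by
  obtain ⟨S, hS⟩ : ∃ S : ℕ → St, S = fun n => run (histM M B n) := ⟨_, rfl⟩
  have hsucc : ∀ n, S (n+1) = upd (S n) (histM M B n) (histM M B (n+1)) := by
    intro n; subst hS; exact run_succ M B n
  have hI : ∀ n, Inv M (S n) (histM M B n) := by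
    intro n
    induction n with
    | zero => subst hS; simp only [run_zero]; exact inv_init M
    | succ n ih =>
      rw [hsucc]
      apply inv_upd ih
      refine ⟨n, ?_⟩
      rw [hf n]
      subst hS
      exact strat_spec ih.av
  have hmono : Monotone (fun n => (S n).P) := by
    apply monotone_nat_of_le_succ
    intro n
    simp only [hsucc n]
    exact upd_mono _ _ _
  obtain ⟨T, hT⟩ : ∃ T : Set (List ℕ), T = {p | ∃ n, p ∈ (S n).P} := ⟨_, rfl⟩
  have hTm : ∀ p, p ∈ T ↔ ∃ n, p ∈ (S n).P := by intro p; rw [hT]; rfl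
  have hTinf : T.Infinite := by
    intro hfin
    obtain ⟨L, hL⟩ : ∃ L, ∀ p ∈ T, p.length ≤ L := by
      obtain ⟨L, hL⟩ := (hfin.image List.length).bddAbove
      exact ⟨L, fun p hp => hL ⟨p, hp, rfl⟩⟩
    have hl : ∀ n, (S n).l.length ≤ L := fun n => hL _ ((hTm _).2 ⟨n, (hI n).cur⟩)
    have hc : ∀ n, (S n).P.card ≤ hfin.toFinset.card := by
      intro n
      apply Finset.card_le_card
      intro p hp
      simpa using (hTm p).2 ⟨n, hp⟩
    have hpot : ∀ n, n ≤ (L+1) * (S n).P.card + (S n).l.length := by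
      intro n
      induction n with
      | zero => simp
      | succ n ih =>
        have := upd_pot (S n) (histM M B n) (histM M B (n+1)) L (hI n).notin (hl n)
        rw [hsucc]; omega
    have h1 := hpot ((L+1) * hfin.toFinset.card + L + 1)
    have h2 := hl ((L+1) * hfin.toFinset.card + L + 1)
    have h3 := Nat.mul_le_mul_left (L+1) (hc ((L+1) * hfin.toFinset.card + L + 1))
    omega
  have htl : ∀ c p, c :: p ∈ T → p ∈ T := by
    intro c p h
    obtain ⟨n, hn⟩ := (hTm _).1 h
    exact (hTm _).2 ⟨n, (hI n).tl c p hn⟩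
  have htl' : ∀ t p, t ++ p ∈ T → p ∈ T := by
    intro t
    induction t with
    | nil => intro p h; exact h
    | cons a t ih => intro p h; exact ih p (htl _ _ h)
  have hch : ∀ p, {c | c :: p ∈ T}.Finite := by
    intro p
    by_contra hinf
    obtain ⟨F, hF, hcard⟩ := Set.Infinite.exists_subset_card_eq hinf (2 * p.length + 2)
    have : ∀ F : Finset ℕ, (∀ c ∈ F, c :: p ∈ T) → ∃ n, ∀ c ∈ F, c :: p ∈ (S n).P := by
      intro F
      induction F using Finset.induction_on with
      | empty => intro _; exact ⟨0, by simp⟩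
      | insert a F _ ih =>
        intro h
        obtain ⟨n, hn⟩ := ih (fun c hc => h c (Finset.mem_insert_of_mem hc))
        obtain ⟨k, hk⟩ := (hTm _).1 (h a (Finset.mem_insert_self _ _))
        refine ⟨max n k, fun c hc => ?_⟩
        rcases Finset.mem_insert.1 hc with rfl | hc
        · exact hmono (le_max_right n k) hk
        · exact hmono (le_max_left n k) (hn c hc)
    obtain ⟨n, hn⟩ := this F (fun c hc => hF hc)
    have := (hI n).br p F hn
    omega
  have hstep : ∀ p : {p : List ℕ // {m | m ∈ T ∧ p <:+ m}.Infinite},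
      ∃ c, {m | m ∈ T ∧ (c :: p.1) <:+ m}.Infinite := by
    rintro ⟨p, hp⟩
    by_contra! hcon
    apply hp
    apply ((Set.finite_singleton p).union ((hch p).biUnion
      (fun c _ => hcon c))).subset
    rintro m ⟨hm, t, rfl⟩
    rcases List.eq_nil_or_concat t with rfl | ⟨t', c, rfl⟩
    · left; simp
    · right
      simp only [List.concat_eq_append, List.append_assoc, List.cons_append, List.nil_append] at hm ⊢
      refine Set.mem_biUnion (x := c) (htl' _ _ hm) ⟨hm, t', rfl⟩
  choose g hg using hstep
  obtain ⟨q, hq0, hq⟩ : ∃ q : ℕ → {p : List ℕ // {m | m ∈ T ∧ p <:+ m}.Infinite},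
      (q 0).1 = [] ∧ ∀ n, (q (n+1)).1 = g (q n) :: (q n).1 :=
    ⟨fun n => Nat.rec ⟨[], by simpa using hTinf⟩ (fun _ p => ⟨g p :: p.1, hg p⟩) n,
      rfl, fun n => rfl⟩
  have hlen : ∀ n, (q n).1.length = n := by
    intro n
    induction n with
    | zero => rw [hq0]; rfl
    | succ n ih => rw [hq, List.length_cons, ih]
  have hqT : ∀ n, (q n).1 ∈ T := by
    intro n
    obtain ⟨m, hm, t, rfl⟩ := (q n).2.nonempty
    exact htl' _ _ hm
  have hqm : ∀ a, Monotone (fun n => a ∈ (q n).1) := by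
    intro a
    apply monotone_nat_of_le_succ
    intro n h
    rw [hq]
    exact List.mem_cons_of_mem _ h
  refine ⟨{a | ∃ n, a ∈ (q n).1}, ?_, ?_⟩
  · intro hfin
    have h1 : (q (hfin.toFinset.card + 1)).1.toFinset ⊆ hfin.toFinset := by
      intro a ha
      simp only [Set.Finite.mem_toFinset]
      exact ⟨_, List.mem_toFinset.1 ha⟩
    have h2 := Finset.card_le_card h1
    obtain ⟨k, hk⟩ := (hTm _).1 (hqT (hfin.toFinset.card + 1))
    rw [List.toFinset_card_of_nodup ((hI k).nodup _ hk), hlen] at h2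
    omega
  · rintro u ⟨n, hu⟩ v ⟨k, hv⟩ huv
    have hu' := hqm u (le_max_left n k) hu
    have hv' := hqm v (le_max_right n k) hv
    obtain ⟨j, hj⟩ := (hTm _).1 (hqT (max n k))
    have hsym : Std.Symm (ME M) := ⟨by
      rintro a b ⟨i, hi⟩
      exact ⟨i, by rw [hi, Sym2.eq_swap]⟩⟩
    exact ((hI j).pw _ hj).forall hu' hv' huv

end KGame

/-- Maker has a winning strategy in the Maker-Breaker K^{ℵ₀}-building game. -/
theorem maker_wins_K_aleph0 :
    ∃ σ : List Edge → Edge, ValidStrat σ ∧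
      ∀ M B : ℕ → Edge, IsPlay M B → FollowsMaker σ M B →
        ∃ W : Set ℕ, W.Infinite ∧ BuildsClique M W :=
  ⟨KGame.strat, KGame.strat_valid, fun M B _ hf => KGame.main M B hf⟩
end

section
/- For every fixed k ≥ 1, Maker wins the (1 : k) biased Maker-Breaker K^{ℵ₀}-building game: there exists a valid Maker strategy such that in every biased play following it, in which Breaker claims exactly k previously unclaimed edges on each of his turns, there is an infinite set W ⊆ ℕ all of whose edges are among Maker's claimed edges. -/
/-- A biased play with bias sequence `b`: Maker claims a single edge per turn,
Breaker claims a set of `b n` edges on his n-th turn, and all claimed edges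
are distinct. -/
def IsBiasedPlay (b : ℕ → ℕ) (M : ℕ → Edge) (B : ℕ → Finset Edge) : Prop :=
  (∀ n, (B n).card = b n) ∧
  Function.Injective M ∧
  (∀ m n, m ≠ n → Disjoint (B m) (B n)) ∧
  (∀ n i, i ≤ n → M i ∉ B n) ∧
  (∀ n i, i ≤ n → M (n + 1) ∉ B i)

/-- The history of complete rounds (Maker's move, Breaker's response) before
Maker's n-th move. -/
def biasedHist (M : ℕ → Edge) (B : ℕ → Finset Edge) : ℕ → List (Edge × Finset Edge)
  | 0 => []
  | n + 1 => biasedHist M B n ++ [(M n, B n)]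

/-- A Maker strategy for the biased game is valid if it never names an already
claimed edge. -/
def ValidBiasedMaker (σ : List (Edge × Finset Edge) → Edge) : Prop :=
  ∀ h, ∀ p ∈ h, σ h ≠ p.1 ∧ σ h ∉ p.2

/-- The biased play (M, B) follows the Maker strategy σ. -/
def FollowsBiasedMaker (σ : List (Edge × Finset Edge) → Edge)
    (M : ℕ → Edge) (B : ℕ → Finset Edge) : Prop :=
  ∀ n, M n = σ (biasedHist M B n)

def claimedIn (h : List (Edge × Finset Edge)) (e : Edge) : Prop :=
  ∃ p ∈ h, e = p.1 ∨ e ∈ p.2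

def downIn (h : List (Edge × Finset Edge)) (w : ℕ) : Set ℕ :=
  {u | u < w ∧ ∃ p ∈ h, (p.1 : Sym2 ℕ) = s(u, w)}

def GoodMove (h : List (Edge × Finset Edge)) (e : Edge) : Prop :=
  ¬ claimedIn h e ∧
  ((∃ l ∈ h.getLast?, ∃ c < l.1.1.sup, downIn h c = downIn h l.1.1.sup ∧
      (e : Sym2 ℕ) = s(c, l.1.1.sup)) ∨
   ((∀ l ∈ h.getLast?, ∀ c < l.1.1.sup, downIn h c = downIn h l.1.1.sup →
      ∃ e' : Edge, (e' : Sym2 ℕ) = s(c, l.1.1.sup) ∧ claimedIn h e') ∧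
    ∃ N > 0, (e : Sym2 ℕ) = s(0, N) ∧ ∀ e', claimedIn h e' → ∀ x ∈ (e' : Sym2 ℕ), x < N))

theorem fresh_exists (h : List (Edge × Finset Edge)) :
    ∃ N > 0, ∀ e', claimedIn h e' → ∀ x ∈ (e' : Sym2 ℕ), x < N := by
  have hf : {e | claimedIn h e}.Finite := by
    have : {e | claimedIn h e} = ⋃ p ∈ {p | p ∈ h}, ({p.1} ∪ (p.2 : Set Edge)) := by
      ext e; simp [claimedIn]
    rw [this]
    refine Set.Finite.biUnion (List.finite_toSet h) ?_
    intro p _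
    exact (Set.finite_singleton _).union (Finset.finite_toSet _)
  obtain ⟨R, hR⟩ := (hf.image (fun e : Edge => (e : Sym2 ℕ).sup)).bddAbove
  refine ⟨R + 1, by omega, ?_⟩
  intro e' he' x hx
  have h1 : (e' : Sym2 ℕ).sup ≤ R := hR ⟨e', he', rfl⟩
  have h2 : x ≤ (e' : Sym2 ℕ).sup := by
    generalize (e' : Sym2 ℕ) = z at hx
    induction z with
    | _ p q => simp at hx ⊢; omega
  omega

theorem good_exists (h : List (Edge × Finset Edge)) : ∃ e, GoodMove h e := by
  by_cases hg : ∃ l ∈ h.getLast?, ∃ c < l.1.1.sup, downIn h c = downIn h l.1.1.sup ∧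
      ∃ e : Edge, (e : Sym2 ℕ) = s(c, l.1.1.sup) ∧ ¬ claimedIn h e
  · obtain ⟨l, hl, c, hc, hd, e, he, hn⟩ := hg
    exact ⟨e, hn, Or.inl ⟨l, hl, c, hc, hd, he⟩⟩
  · obtain ⟨N, hN, hf⟩ := fresh_exists h
    have hne : ¬ (s(0, N) : Sym2 ℕ).IsDiag := by simp; omega
    refine ⟨⟨s(0, N), hne⟩, ?_, Or.inr ⟨?_, N, hN, rfl, hf⟩⟩
    · intro hc
      have := hf _ hc N (by simp)
      omega
    · intro l hl c hc hd
      by_contra hcon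
      apply hg
      have hne' : ¬ (s(c, l.1.1.sup) : Sym2 ℕ).IsDiag := by simp; omega
      refine ⟨l, hl, c, hc, hd, ⟨_, hne'⟩, rfl, ?_⟩
      intro h3
      exact hcon ⟨_, rfl, h3⟩

/-- König part. -/
theorem konig_part (D : ℕ → Set ℕ) (hlt : ∀ w, ∀ u ∈ D w, u < w)
    (htree : ∀ w, ∀ u ∈ D w, ∀ x, x ∈ D u ↔ (x ∈ D w ∧ x < u))
    (h0 : {w | 0 ∈ D w}.Infinite)
    (hfin : ∀ S : Set ℕ, S.Nonempty → {w | D w = S}.Finite) :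
    ∃ W : Set ℕ, W.Infinite ∧ ∀ u ∈ W, ∀ v ∈ W, u < v → u ∈ D v := by
  classical
  let F : Filter ℕ := Filter.cofinite ⊓ Filter.principal {w | 0 ∈ D w}
  haveI : F.NeBot := by
    exact Filter.cofinite_inf_principal_neBot_iff.mpr h0
  let U : Ultrafilter ℕ := Ultrafilter.of F
  have hU : (U : Filter ℕ) ≤ F := Ultrafilter.of_le F
  refine ⟨{u | {v | u ∈ D v} ∈ U}, ?_, ?_⟩
  · intro hW
    have h0W : 0 ∈ {u | {v | u ∈ D v} ∈ U} :=
      hU (Filter.mem_inf_of_right (Filter.mem_principal_self _))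
    obtain ⟨m, hmW, hmax⟩ := Set.exists_max_image _ id hW ⟨0, h0W⟩
    have hC := hfin (insert m (D m)) ⟨m, by simp⟩
    have hev : (⋃ c ∈ {w | D w = insert m (D m)}, {v | c ∈ D v ∨ v = c}) ∈ U := by
      refine Filter.mem_of_superset hmW ?_
      intro v hv
      have hv : m ∈ D v := hv
      simp only [Set.mem_iUnion]
      by_cases hex : ∃ u, u ∈ D v ∧ m < u
      · refine ⟨Nat.find hex, ?_, Or.inl (Nat.find_spec hex).1⟩
        ext x
        rw [htree v _ (Nat.find_spec hex).1, Set.mem_insert_iff, htree v m hv]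
        constructor
        · rintro ⟨hx, hx2⟩
          have := Nat.find_min hex hx2
          have h3 : ¬ m < x := fun h => this ⟨hx, h⟩
          rcases Nat.lt_or_ge x m with h | h
          · exact Or.inr ⟨hx, h⟩
          · left; omega
        · have := (Nat.find_spec hex).2
          rintro (rfl | ⟨hx, hx2⟩)
          · exact ⟨hv, this⟩
          · exact ⟨hx, by omega⟩
      · refine ⟨v, ?_, Or.inr rfl⟩
        ext x
        rw [Set.mem_insert_iff, htree v m hv]
        constructor
        · intro hx
          have h3 : ¬ m < x := fun h => hex ⟨x, hx, h⟩
          rcases Nat.lt_or_ge x m with h | h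
          · exact Or.inr ⟨hx, h⟩
          · left; omega
        · rintro (rfl | ⟨hx, hx2⟩)
          · exact hv
          · exact hx
    obtain ⟨c, hc, hcU⟩ := (Ultrafilter.finite_biUnion_mem_iff hC).mp hev
    have hne : {c}ᶜ ∈ U := by
      apply hU
      apply Filter.mem_inf_of_left
      simp
    have hcW : {v | c ∈ D v} ∈ U := by
      refine Filter.mem_of_superset (Filter.inter_mem hcU hne) ?_
      rintro v ⟨h1 | h1, h2⟩
      · exact h1
      · exact absurd h1 h2
    have h5 : c ≤ m := hmax c hcW
    have h6 : m ∈ D c := by rw [show D c = _ from hc]; simp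
    have := hlt _ _ h6
    omega
  · intro u hu v hv huv
    obtain ⟨x, hx1, hx2⟩ := U.nonempty_of_mem (Filter.inter_mem hu hv)
    exact (htree x v hx2 u).mpr ⟨hx1, huv⟩

theorem finite_of_few_below (X : Set ℕ) (K : ℕ)
    (h : ∀ w ∈ X, ∀ t : Finset ℕ, (∀ c ∈ t, c ∈ X ∧ c < w) → t.card ≤ K) : X.Finite := by
  by_contra hX
  obtain ⟨t, ht, hc⟩ := Set.Infinite.exists_subset_card_eq hX (K + 2)
  have hne : t.Nonempty := by rw [← Finset.card_pos]; omega
  have := h (t.max' hne) (ht (t.max'_mem hne)) (t.erase (t.max' hne)) (by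
    intro c hc
    refine ⟨ht (Finset.mem_of_mem_erase hc), ?_⟩
    exact Finset.lt_max'_of_mem_erase_max' _ _ hc)
  rw [Finset.card_erase_of_mem (t.max'_mem hne)] at this
  omega

theorem mem_biasedHist (M : ℕ → Edge) (B : ℕ → Finset Edge) (n : ℕ) (p : Edge × Finset Edge) :
    p ∈ biasedHist M B n ↔ ∃ i < n, p = (M i, B i) := by
  induction n with
  | zero => simp [biasedHist]
  | succ n ih =>
    simp only [biasedHist, List.mem_append, ih, List.mem_singleton]
    constructor
    · rintro (⟨i, hi, rfl⟩ | rfl)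
      · exact ⟨i, by omega, rfl⟩
      · exact ⟨n, by omega, rfl⟩
    · rintro ⟨i, hi, rfl⟩
      rcases Nat.lt_succ_iff_lt_or_eq.mp hi with h | rfl
      · exact Or.inl ⟨i, h, rfl⟩
      · exact Or.inr rfl

def dn (a b : ℕ → ℕ) (n w : ℕ) : Set ℕ := {u | ∃ i < n, a i = u ∧ b i = w}

/-- Combinatorial core. -/
theorem core_part (k : ℕ) (a b : ℕ → ℕ) (B : ℕ → Finset (Sym2 ℕ))
    (hB : ∀ n, (B n).card ≤ k)
    (hab : ∀ n, a n < b n)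
    (hinj : ∀ m n, a m = a n → b m = b n → m = n)
    (ha0 : a 0 = 0)
    (hstep : ∀ n, (b (n+1) = b n ∧ dn a b (n+1) (a (n+1)) = dn a b (n+1) (b n)) ∨
      (a (n+1) = 0 ∧ (∀ i ≤ n, b i < b (n+1)) ∧
        (∀ i ≤ n, ∀ e ∈ B i, ∀ x ∈ e, x < b (n+1)) ∧
        (∀ c < b n, dn a b (n+1) c = dn a b (n+1) (b n) →
          ∃ i ≤ n, (a i = c ∧ b i = b n) ∨ s(c, b n) ∈ B i))) :
    ∃ W : Set ℕ, W.Infinite ∧ ∀ u ∈ W, ∀ v ∈ W, u < v → ∃ i, a i = u ∧ b i = v := by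
  classical
  let D : ℕ → Set ℕ := fun w => {u | ∃ i, a i = u ∧ b i = w}
  have hmono : Monotone b := by
    refine monotone_nat_of_le_succ fun n => ?_
    rcases hstep n with h | h
    · exact h.1.ge
    · exact (h.2.1 n le_rfl).le
  have hlt : ∀ w, ∀ u ∈ D w, u < w := by
    rintro w u ⟨i, rfl, rfl⟩; exact hab i
  have hdn : ∀ n w, w < b n → dn a b n w = D w := by
    intro n w hw
    ext u
    constructor
    · rintro ⟨i, _, h⟩; exact ⟨i, h⟩
    · rintro ⟨i, h1, h2⟩
      refine ⟨i, ?_, h1, h2⟩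
      by_contra hcon
      have := hmono (not_lt.mp hcon)
      omega
  have hdn1 : ∀ n w, w < b n → dn a b (n+1) w = D w := fun n w hw =>
    hdn _ _ (lt_of_lt_of_le hw (hmono (Nat.le_succ n)))
  have hD0 : D 0 = ∅ := by
    ext u; simp only [Set.mem_empty_iff_false, iff_false]
    intro h; have := hlt 0 u h; omega
  have hinv : ∀ n, dn a b (n+1) (b n) = insert (a n) (D (a n)) := by
    intro n
    have hs : dn a b (n+1) (b n) = insert (a n) (dn a b n (b n)) := by
      ext u
      simp only [dn, Set.mem_setOf_eq, Set.mem_insert_iff]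
      constructor
      · rintro ⟨i, hi, h1, h2⟩
        rcases Nat.lt_succ_iff_lt_or_eq.mp hi with h | rfl
        · exact Or.inr ⟨i, h, h1, h2⟩
        · exact Or.inl h1.symm
      · rintro (rfl | ⟨i, hi, h⟩)
        · exact ⟨n, by omega, rfl, rfl⟩
        · exact ⟨i, by omega, h⟩
    rw [hs]
    congr 1
    cases n with
    | zero =>
      rw [ha0, hD0]
      ext u; simp [dn]
    | succ n =>
      rcases hstep n with ⟨h1, h2⟩ | ⟨h1, h2, _⟩
      · rw [h1, ← h2]
        exact hdn1 _ _ (h1 ▸ hab (n+1))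
      · rw [h1, hD0]
        ext u
        simp only [dn, Set.mem_setOf_eq, Set.mem_empty_iff_false, iff_false]
        rintro ⟨i, hi, _, h4⟩
        have := h2 i (by omega)
        omega
  have htree : ∀ w, ∀ u ∈ D w, ∀ x, x ∈ D u ↔ (x ∈ D w ∧ x < u) := by
    rintro w u ⟨n, rfl, rfl⟩ x
    constructor
    · intro hx
      refine ⟨?_, hlt _ _ hx⟩
      have : x ∈ dn a b (n+1) (b n) := by rw [hinv]; exact Or.inr hx
      obtain ⟨i, _, h⟩ := this
      exact ⟨i, h⟩
    · rintro ⟨⟨m, rfl, hm⟩, hx⟩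
      by_cases hmn : m ≤ n
      · have : a m ∈ dn a b (n+1) (b n) := ⟨m, by omega, rfl, hm⟩
        rw [hinv] at this
        rcases this with h | h
        · omega
        · exact h
      · have : a n ∈ dn a b (m+1) (b m) := ⟨n, by omega, rfl, hm.symm⟩
        rw [hinv] at this
        rcases this with h | h
        · omega
        · have := hlt _ _ h
          omega
  have h0b : ∀ n, 0 ∈ D (b n) := by
    intro n
    induction n with
    | zero => exact ⟨0, ha0, rfl⟩
    | succ n ih =>
      rcases hstep n with ⟨h1, h2⟩ | ⟨h1, h2, _⟩
      · rw [h1]; exact ih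
      · exact ⟨n+1, h1, rfl⟩
  have hunb : ∀ R, ∃ n, R < b n := by
    intro R
    by_contra hcon
    push Not at hcon
    have hi : Function.Injective (fun n => ((⟨a n, by have := hcon n; have := hab n; omega⟩,
        ⟨b n, by have := hcon n; omega⟩) : Fin (R+1) × Fin (R+1))) := by
      intro m n h
      simp only [Prod.mk.injEq, Fin.mk.injEq] at h
      exact hinj m n h.1 h.2
    exact not_injective_infinite_finite _ hi
  have h0 : {w | 0 ∈ D w}.Infinite := by
    rw [Set.infinite_iff_exists_gt]
    intro R
    obtain ⟨n, hn⟩ := hunb R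
    exact ⟨b n, h0b n, hn⟩
  have hfresh : ∀ i, ∀ e ∈ B i, ∀ d, b (i + d) = b i ∨ ∀ x ∈ e, x < b (i+d) := by
    intro i e he d
    induction d with
    | zero => left; rfl
    | succ d ih =>
      rcases hstep (i+d) with ⟨h1, _⟩ | ⟨_, _, h3, _⟩
      · rw [← add_assoc, h1]; exact ih
      · right; exact h3 i (by omega) e he
  refine konig_part D hlt htree h0 ?_
  intro S hS
  have hSfin : {w | D w = S}.Nonempty → S.Finite := by
    rintro ⟨w, rfl⟩
    exact (Set.finite_Iio w).subset (fun u hu => hlt _ _ hu)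
  refine finite_of_few_below _ (k * S.ncard) ?_
  intro w hw t ht
  have hSf := hSfin ⟨w, hw⟩
  have hw : D w = S := hw
  -- last move of w
  obtain ⟨n, hn, hn1⟩ : ∃ n, b n = w ∧ b (n+1) ≠ w := by
    obtain ⟨u, hu⟩ := hS
    rw [← hw] at hu
    obtain ⟨m, _, hm⟩ := hu
    have hex := hunb w
    have hfs := Nat.find_spec hex
    have hmj : m < Nat.find hex := by
      by_contra hcon
      have := hmono (not_lt.mp hcon)
      omega
    obtain ⟨j, hj⟩ : ∃ j, Nat.find hex = j + 1 := ⟨Nat.find hex - 1, by omega⟩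
    refine ⟨j, ?_, ?_⟩
    · have h1 := Nat.find_min hex (m := j) (by omega)
      have h2 : b m ≤ b j := hmono (by omega)
      omega
    · rw [← hj]; omega
  rcases hstep n with ⟨h1, _⟩ | ⟨_, hbig, _, hall⟩
  · omega
  have hDw : dn a b (n+1) w = D w := hdn _ _ (hn ▸ hbig n le_rfl)
  let I : Finset ℕ := (Finset.range (n+1)).filter (fun i => b i = w)
  have hI : I.card ≤ S.ncard := by
    rw [Set.ncard_eq_toFinset_card S hSf]
    refine Finset.card_le_card_of_injOn a ?_ ?_
    · intro i hi
      simp only [I, Finset.coe_filter, Set.mem_setOf_eq] at hi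
      simp only [Set.Finite.coe_toFinset]
      rw [← hw]
      exact ⟨i, rfl, hi.2⟩
    · intro i hi j hj hij
      simp only [I, Finset.coe_filter, Set.mem_setOf_eq] at hi hj
      exact hinj i j hij (hi.2.trans hj.2.symm)
  have h2 : t.card ≤ (I.biUnion B).card := by
    refine Finset.card_le_card_of_injOn (fun c => s(c, w)) ?_ ?_
    · intro c hc
      obtain ⟨hcD, hcw⟩ := ht c hc
      have hcD : D c = S := hcD
      obtain ⟨i, hi, h⟩ := hall c (by omega) (by rw [hn, hDw, hw, ← hcD]; exact hdn1 _ _ (by omega))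
      rcases h with h | h
      · have : c ∈ D w := ⟨i, h.1, by omega⟩
        rw [hw, ← hcD] at this
        exact absurd (hlt _ _ this) (lt_irrefl _)
      · rw [hn] at h
        simp only [Finset.coe_biUnion, Set.mem_iUnion]
        refine ⟨i, ?_, h⟩
        simp only [I, Finset.coe_filter, Set.mem_setOf_eq, Finset.mem_range]
        refine ⟨by omega, ?_⟩
        rcases hfresh i _ h (n - i) with h3 | h3
        · rw [← h3, Nat.add_sub_cancel' hi, hn]
        · have := h3 w (by simp)
          rw [Nat.add_sub_cancel' hi] at this
          omega
    · intro c hc c' hc' h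
      have h1 := (ht c hc).2
      have h2 := (ht c' hc').2
      simp only [Sym2.eq_iff] at h
      omega
  calc t.card ≤ (I.biUnion B).card := h2
    _ ≤ I.card * k := Finset.card_biUnion_le_card_mul _ _ _ (fun i _ => hB i)
    _ ≤ k * S.ncard := by rw [mul_comm]; exact Nat.mul_le_mul_left _ hI

theorem edge_eq (e : Edge) : (e : Sym2 ℕ).inf < (e : Sym2 ℕ).sup ∧
    (e : Sym2 ℕ) = s((e : Sym2 ℕ).inf, (e : Sym2 ℕ).sup) := by
  obtain ⟨z, hz⟩ := e
  induction z with
  | _ p q =>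
    simp at hz ⊢
    omega

/-- For every fixed k ≥ 1, Maker wins the (1 : k) biased Maker-Breaker
K^{ℵ₀}-building game. -/
theorem maker_wins_biased_K_aleph0 (k : ℕ) (hk : 1 ≤ k) :
    ∃ σ : List (Edge × (Finset Edge)) → Edge, ValidBiasedMaker σ ∧
      ∀ (M : ℕ → Edge) (B : ℕ → Finset Edge),
        IsBiasedPlay (fun _ => k) M B → FollowsBiasedMaker σ M B →
          ∃ W : Set ℕ, W.Infinite ∧ BuildsClique M W := by
  classical
  choose σ hσ using good_exists
  refine ⟨σ, ?_, ?_⟩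
  · intro h p hp
    have := (hσ h).1
    exact ⟨fun e => this ⟨p, hp, Or.inl e⟩, fun e => this ⟨p, hp, Or.inr e⟩⟩
  intro M B hplay hfol
  obtain ⟨hcard, hMinj, -, -, -⟩ := hplay
  have hG : ∀ n, GoodMove (biasedHist M B n) (M n) := fun n => by rw [hfol n]; exact hσ _
  let a : ℕ → ℕ := fun n => (M n : Sym2 ℕ).inf
  let b : ℕ → ℕ := fun n => (M n : Sym2 ℕ).sup
  have hab : ∀ n, a n < b n := fun n => (edge_eq (M n)).1
  have hM : ∀ n, (M n : Sym2 ℕ) = s(a n, b n) := fun n => (edge_eq (M n)).2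
  have hMiff : ∀ n u w, u < w → ((M n : Sym2 ℕ) = s(u, w) ↔ a n = u ∧ b n = w) := by
    intro n u w huw
    rw [hM n, Sym2.eq_iff]
    have := hab n
    omega
  have hdown : ∀ n w, downIn (biasedHist M B n) w = dn a b n w := by
    intro n w
    ext u
    simp only [downIn, dn, Set.mem_setOf_eq, mem_biasedHist]
    constructor
    · rintro ⟨huw, p, ⟨i, hi, rfl⟩, h⟩
      exact ⟨i, hi, (hMiff i u w huw).mp h⟩
    · rintro ⟨i, hi, h⟩
      have huw : u < w := by have := hab i; omega
      exact ⟨huw, _, ⟨i, hi, rfl⟩, (hMiff i u w huw).mpr h⟩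
  have hlast : ∀ n, (biasedHist M B (n+1)).getLast? = some (M n, B n) := by
    intro n; simp [biasedHist]
  have hcl : ∀ n e, claimedIn (biasedHist M B n) e ↔ ∃ i < n, e = M i ∨ e ∈ B i := by
    intro n e
    simp only [claimedIn, mem_biasedHist]
    constructor
    · rintro ⟨p, ⟨i, hi, rfl⟩, h⟩; exact ⟨i, hi, h⟩
    · rintro ⟨i, hi, h⟩; exact ⟨_, ⟨i, hi, rfl⟩, h⟩
  obtain ⟨W, hW, hWc⟩ := core_part k a b (fun n => (B n).map ⟨Subtype.val, Subtype.val_injective⟩)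
    (by intro n; rw [Finset.card_map]; exact (hcard n).le) hab
    (by
      intro m n h1 h2
      apply hMinj
      apply Subtype.ext
      rw [hM m, hM n, h1, h2])
    (by
      rcases (hG 0).2 with ⟨l, hl, _⟩ | ⟨_, N, hN, h, _⟩
      · simp [biasedHist] at hl
      · exact ((hMiff 0 0 N hN).mp h).1)
    (by
      intro n
      rcases (hG (n+1)).2 with ⟨l, hl, c, hc, hd, he⟩ | ⟨hno, N, hN, h, hf⟩
      · left
        rw [hlast] at hl
        obtain rfl : (M n, B n) = l := by simpa using hl
        have h3 := (hMiff (n+1) c (b n) hc).mp he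
        refine ⟨h3.2, ?_⟩
        rw [h3.1, ← hdown, ← hdown]
        exact hd
      · right
        have h3 := (hMiff (n+1) 0 N hN).mp h
        refine ⟨h3.1, ?_, ?_, ?_⟩
        · intro i hi
          rw [h3.2]
          exact hf (M i) ((hcl _ _).mpr ⟨i, by omega, Or.inl rfl⟩) (b i) (by rw [hM i]; simp)
        · intro i hi e he x hx
          rw [h3.2]
          simp only [Finset.mem_map, Function.Embedding.coeFn_mk] at he
          obtain ⟨e', he', rfl⟩ := he
          exact hf e' ((hcl _ _).mpr ⟨i, by omega, Or.inr he'⟩) x hx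
        · intro c hc hd
          rw [hlast] at hno
          obtain ⟨e', he', hc'⟩ := hno (M n, B n) rfl c hc (by rw [hdown, hdown]; exact hd)
          obtain ⟨i, hi, h4⟩ := (hcl _ _).mp hc'
          refine ⟨i, by omega, ?_⟩
          rcases h4 with rfl | h4
          · left; exact (hMiff i c (b n) hc).mp he'
          · right
            simp only [Finset.mem_map, Function.Embedding.coeFn_mk]
            exact ⟨e', h4, he'⟩)
  refine ⟨W, hW, ?_⟩
  intro u hu v hv huv
  rcases lt_or_gt_of_ne huv with h | h
  · obtain ⟨i, hi⟩ := hWc u hu v hv h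
    exact ⟨i, (hMiff i u v h).mpr hi⟩
  · obtain ⟨i, hi⟩ := hWc v hv u hu h
    exact ⟨i, by rw [Sym2.eq_swap]; exact (hMiff i v u h).mpr hi⟩
end

section
/- If Breaker's bias grows without bound, Breaker wins: let (b_n) be a nondecreasing sequence of positive integers with b_n → ∞; then Breaker has a valid strategy such that in every biased play following it, in which Breaker claims exactly b_n previously unclaimed edges on his n-th turn, there is no infinite set W ⊆ ℕ all of whose edges are among Maker's claimed edges. -/
/-- A Breaker strategy for the biased game takes a history (a list of complete
rounds together with Maker's latest move) and returns a set of edges. It is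
valid (for bias sequence `b`) if on the n-th turn it always returns exactly
`b n` previously unclaimed edges. -/
def ValidBiasedBreaker (b : ℕ → ℕ) (τ : List (Edge × Finset Edge) × Edge → Finset Edge) : Prop :=
  ∀ (h : List (Edge × Finset Edge)) (e : Edge),
    (τ (h, e)).card = b h.length ∧
    ∀ f ∈ τ (h, e), f ≠ e ∧ ∀ p ∈ h, f ≠ p.1 ∧ f ∉ p.2

/-- The biased play (M, B) follows the Breaker strategy τ. -/
def FollowsBiasedBreaker (τ : List (Edge × Finset Edge) × Edge → Finset Edge)
    (M : ℕ → Edge) (B : ℕ → Finset Edge) : Prop :=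
  ∀ n, B n = τ (biasedHist M B n, M n)

theorem hist_length (M : ℕ → Edge) (B : ℕ → Finset Edge) (n : ℕ) :
    (biasedHist M B n).length = n := by
  induction n with
  | zero => rfl
  | succ n ih => simp [biasedHist, ih]

theorem hist_mem (M : ℕ → Edge) (B : ℕ → Finset Edge) (n : ℕ) (p : Edge × Finset Edge)
    (hp : p ∈ biasedHist M B n) : ∃ i < n, p = (M i, B i) := by
  induction n with
  | zero => simp [biasedHist] at hp
  | succ n ih =>
    simp only [biasedHist, List.mem_append, List.mem_singleton] at hp
    rcases hp with hp | hp
    · obtain ⟨i, hi, h⟩ := ih hp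
      exact ⟨i, by omega, h⟩
    · exact ⟨n, by omega, hp⟩

theorem exists_target (e : Edge) (k : ℕ) : ∃ T : Finset Edge, T.card ≤ 2 * k ∧
    ∀ x ∈ (e : Sym2 ℕ), ∀ w < k, ∀ f : Edge, (f : Sym2 ℕ) = s(x, w) → f ∈ T := by
  classical
  obtain ⟨e, he⟩ := e
  induction e using Sym2.ind with
  | _ a c =>
  let U : Finset (Sym2 ℕ) := (Finset.range k).image (fun w => s(a, w)) ∪
    (Finset.range k).image (fun w => s(c, w))
  have hU : U.card ≤ 2 * k := by
    have h1 := Finset.card_union_le ((Finset.range k).image (fun w => s(a, w)))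
      ((Finset.range k).image (fun w => s(c, w)))
    have h2 := Finset.card_image_le (s := Finset.range k) (f := fun w => s(a, w))
    have h3 := Finset.card_image_le (s := Finset.range k) (f := fun w => s(c, w))
    simp only [Finset.card_range] at h2 h3
    show Finset.card (_ ∪ _) ≤ _
    omega
  refine ⟨U.subtype _, ?_, ?_⟩
  · rw [Finset.card_subtype]
    exact (Finset.card_filter_le _ _).trans hU
  · intro x hx w hw f hf
    rw [Finset.mem_subtype, hf]
    simp only [Sym2.mem_iff] at hx
    rcases hx with rfl | rfl
    · exact Finset.mem_union_left _ (Finset.mem_image.2 ⟨w, Finset.mem_range.2 hw, rfl⟩)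
    · exact Finset.mem_union_right _ (Finset.mem_image.2 ⟨w, Finset.mem_range.2 hw, rfl⟩)

theorem edge_infinite : Infinite Edge := by
  refine Infinite.of_injective (fun n : ℕ => (⟨s(0, n + 1), by simp⟩ : Edge)) ?_
  intro m n h
  simpa using h

theorem exists_response (b : ℕ → ℕ) (q : List (Edge × Finset Edge) × Edge) :
    ∃ S : Finset Edge, S.card = b q.1.length ∧
      (∀ f ∈ S, f ≠ q.2 ∧ ∀ p ∈ q.1, f ≠ p.1 ∧ f ∉ p.2) ∧
      ∀ x ∈ (q.2 : Sym2 ℕ), ∀ w, 2 * (w + 1) ≤ b q.1.length → ∀ f : Edge,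
        (f : Sym2 ℕ) = s(x, w) → f ∈ S ∨ f = q.2 ∨ ∃ p ∈ q.1, f = p.1 ∨ f ∈ p.2 := by
  classical
  haveI := edge_infinite
  obtain ⟨h, e⟩ := q
  let C : Finset Edge := insert e (h.toFinset.biUnion (fun p => insert p.1 p.2))
  have hC : ∀ f, f ∈ C ↔ f = e ∨ ∃ p ∈ h, f = p.1 ∨ f ∈ p.2 := by
    intro f; simp only [C, Finset.mem_insert, Finset.mem_biUnion, List.mem_toFinset]
  obtain ⟨T, hT, hT'⟩ := exists_target e (b h.length / 2)
  obtain ⟨t, ht, htc⟩ := Infinite.exists_superset_card_eq (T ∪ C) (b h.length + C.card) (by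
    have := Finset.card_union_le T C
    omega)
  refine ⟨t \ C, ?_, ?_, ?_⟩
  · rw [Finset.card_sdiff_of_subset (Finset.subset_union_right.trans ht), htc]
    simp
  · intro f hf
    have := (Finset.mem_sdiff.1 hf).2
    rw [hC] at this
    push Not at this
    exact this
  · intro x hx w hw f hf
    by_cases hfC : f ∈ C
    · exact Or.inr ((hC f).1 hfC)
    · left
      simp only at hw
      exact Finset.mem_sdiff.2
        ⟨ht (Finset.mem_union_left _ (hT' x hx w (by omega) f hf)), hfC⟩

/-- If Breaker's bias is nondecreasing and grows without bound, then Breaker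
wins the biased K^{ℵ₀}-building game. -/
theorem breaker_wins_unbounded_bias (b : ℕ → ℕ) (hpos : ∀ n, 1 ≤ b n)
    (hmono : Monotone b) (htop : Filter.Tendsto b Filter.atTop Filter.atTop) :
    ∃ τ : List (Edge × Finset Edge) × Edge → Finset Edge, ValidBiasedBreaker b τ ∧
      ∀ (M : ℕ → Edge) (B : ℕ → Finset Edge),
        IsBiasedPlay b M B → FollowsBiasedBreaker τ M B →
          ¬ ∃ W : Set ℕ, W.Infinite ∧ BuildsClique M W := by
  classical
  choose τ h1 h2 h3 using exists_response b
  refine ⟨τ, fun h e => ⟨h1 (h, e), h2 (h, e)⟩, ?_⟩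
  rintro M B ⟨-, hinj, -, -, hMB⟩ hfol ⟨W, hW, hcl⟩
  obtain ⟨w0, hw0⟩ := hW.nonempty
  obtain ⟨w1, hw1, hw10⟩ := hW.exists_notMem_finset {w0}
  obtain ⟨N, hN⟩ := Filter.eventually_atTop.1 (htop.eventually_ge_atTop (2 * (w0 + w1 + 1)))
  obtain ⟨v, hv, hvn⟩ := hW.exists_notMem_finset
    ({w0, w1} ∪ (Finset.range N).biUnion (fun i => (M i : Sym2 ℕ).toFinset))
  simp only [Finset.mem_union, Finset.mem_insert, Finset.mem_singleton, Finset.mem_biUnion,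
    Finset.mem_range, Sym2.mem_toFinset, not_or, not_exists, not_and] at hvn hw10
  obtain ⟨⟨hv0, hv1⟩, hvN⟩ := hvn
  have hex : ∃ n, v ∈ (M n : Sym2 ℕ) := by
    obtain ⟨n, hn⟩ := hcl v hv w0 hw0 hv0
    exact ⟨n, by rw [hn]; simp⟩
  set n := Nat.find hex with hn
  have hnv : v ∈ (M n : Sym2 ℕ) := Nat.find_spec hex
  have hmin : ∀ m, v ∈ (M m : Sym2 ℕ) → n ≤ m := fun m hm => Nat.find_min' hex hm
  have hNn : N ≤ n := by
    by_contra hlt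
    exact hvN n (by omega) hnv
  have key : ∀ w ∈ W, v ≠ w → w ≤ w0 + w1 → (M n : Sym2 ℕ) = s(v, w) := by
    intro w hw hvw hle
    obtain ⟨m, hm⟩ := hcl v hv w hw hvw
    have hnm : n ≤ m := hmin m (by rw [hm]; simp)
    rcases hnm.eq_or_lt with heq | hlt
    · rw [heq]; exact hm
    exfalso
    have hB : ∀ i ≤ n, M m ∉ B i := by
      intro i hi
      obtain ⟨m', rfl⟩ : ∃ m', m = m' + 1 := ⟨m - 1, by omega⟩
      exact hMB m' i (by omega)
    have := h3 (biasedHist M B n, M n) v hnv w (by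
      simp only [hist_length]
      have := hN n hNn
      omega) (M m) hm
    rw [← hfol n] at this
    rcases this with h | h | ⟨p, hp, h⟩
    · exact hB n le_rfl h
    · exact absurd (hinj h) (by omega)
    · obtain ⟨i, hi, rfl⟩ := hist_mem M B n p hp
      rcases h with h | h
      · exact absurd (hinj h) (by omega)
      · exact hB i hi.le h
  have e0 := key w0 hw0 hv0 (by omega)
  have e1 := key w1 hw1 hv1 (by omega)
  rw [e0] at e1
  exact hw10 (Sym2.congr_right.1 e1).symm
end

section
/- In the vertex-coloured game with finitely many colours, Maker wins: let k ≥ 1 and let c : ℕ → Fin k be a colouring of the vertices such that every colour class c⁻¹(i) is infinite. Then Maker has a valid strategy such that in every play following it there is an infinite set W ⊆ ℕ with every edge having both endpoints in W among Maker's claimed edges, and moreover W ∩ c⁻¹(i) is infinite for every colour i ∈ Fin k. -/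
/-- The play (M, B) follows the Breaker strategy τ. -/
def FollowsBreaker (τ : List Edge → Edge) (M B : ℕ → Edge) : Prop :=
  ∀ n, B n = τ (histB M B n)

open Classical in
/-- finite-horizon strategy trees for Maker -/
inductive FT (G : Finset (Sym2 ℕ) → Prop) : Finset (Sym2 ℕ) → Finset (Sym2 ℕ) → Type
  | done (m h : Finset (Sym2 ℕ)) : G m → FT G m h
  | step (m h : Finset (Sym2 ℕ)) (e : Edge) : e.1 ∉ h →
      (∀ b : Edge, FT G (insert e.1 m) (insert b.1 (insert e.1 h))) → FT G m h

open Classical in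
noncomputable def touched (h : Finset (Sym2 ℕ)) (U : Finset ℕ) : ℕ :=
  (h.filter (fun e => ∃ u ∈ U, u ∈ e)).card

lemma touched_insert (h : Finset (Sym2 ℕ)) (U : Finset ℕ) (e : Sym2 ℕ) :
    touched (insert e h) U ≤ touched h U + 1 := by
  classical
  unfold touched
  rw [Finset.filter_insert]
  split_ifs
  · exact Finset.card_insert_le _ _
  · omega

lemma touched_mono (h : Finset (Sym2 ℕ)) {U V : Finset ℕ} (hUV : U ⊆ V) :
    touched h U ≤ touched h V := by
  classical
  unfold touched
  apply Finset.card_le_card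
  intro e
  simp only [Finset.mem_filter]
  rintro ⟨h1, u, hu, h2⟩
  exact ⟨h1, u, hUV hu, h2⟩

lemma avail_insert {k : ℕ} (c : ℕ → Fin k) (i : Fin k) (a : ℕ) (U : Finset ℕ)
    (h : Finset (Sym2 ℕ)) (e : Sym2 ℕ) :
    (U.filter (fun u => c u = i ∧ s(u, a) ∉ h)).card ≤
      (U.filter (fun u => c u = i ∧ s(u, a) ∉ insert e h)).card + 1 := by
  classical
  have key : ∃ w : ℕ, ∀ u, s(u, a) = e → u = w := by
    by_cases hw : ∃ w, s(w, a) = e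
    · obtain ⟨w, rfl⟩ := hw
      exact ⟨w, fun u hu => by rcases Sym2.eq_iff.1 hu with h | h <;> omega⟩
    · exact ⟨0, fun u hu => absurd ⟨u, hu⟩ hw⟩
  obtain ⟨w, hw⟩ := key
  calc _ ≤ (insert w (U.filter (fun u => c u = i ∧ s(u, a) ∉ insert e h))).card := by
        apply Finset.card_le_card
        intro u
        simp only [Finset.mem_filter, Finset.mem_insert, not_or]
        rintro ⟨h1, h2, h3⟩
        by_cases hu : s(u, a) = e
        · exact Or.inl (hw u hu)
        · exact Or.inr ⟨h1, h2, hu, h3⟩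
    _ ≤ _ := Finset.card_insert_le _ _

lemma card_colours {k : ℕ} (c : ℕ → Fin k) (S : Finset ℕ) :
    S.card = ∑ i : Fin k, (S.filter (fun u => c u = i)).card :=
  Finset.card_eq_sum_card_fiberwise (fun _ _ => Finset.mem_coe.2 (Finset.mem_univ _))

lemma phase {k : ℕ} (c : ℕ → Fin k) (G : Finset (Sym2 ℕ) → Prop) (m0 : Finset (Sym2 ℕ))
    (a : ℕ) (U : Finset ℕ) (ha : a ∉ U) (n' g : ℕ)
    (cont : ∀ (S : Finset ℕ) (m h : Finset (Sym2 ℕ)), S ⊆ U → m0 ⊆ m → (∀ u ∈ S, s(u, a) ∈ m) →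
      (∀ i, n' ≤ (S.filter (fun u => c u = i)).card) → touched h S ≤ g → Nonempty (FT G m h)) :
    ∀ (r : ℕ) (S : Finset ℕ) (m h : Finset (Sym2 ℕ)), S ⊆ U → m0 ⊆ m → (∀ u ∈ S, s(u, a) ∈ m) →
      (∀ u ∈ S, s(u, a) ∈ h) → (∀ i, (S.filter (fun u => c u = i)).card ≤ n') →
      S.card + r = k * n' →
      (∀ i, 2 * r ≤ (U.filter (fun u => c u = i ∧ s(u, a) ∉ h)).card) →
      touched h U + 2 * r ≤ g → Nonempty (FT G m h) := by
  classical
  intro r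
  induction r with
  | zero =>
    intro S m h hSU hm hSm hSh hle hcard hav ht
    refine cont S m h hSU hm hSm ?_ ((touched_mono h hSU).trans (by omega))
    by_contra! hcon
    obtain ⟨i, hi⟩ := hcon
    have := Finset.sum_lt_sum (s := Finset.univ) (fun j _ => hle j) ⟨i, Finset.mem_univ i, hi⟩
    rw [← card_colours] at this
    simp at this
    omega
  | succ r ih =>
    intro S m h hSU hm hSm hSh hle hcard hav ht
    by_cases hall : ∀ i, n' ≤ (S.filter (fun u => c u = i)).card
    · exact cont S m h hSU hm hSm hall ((touched_mono h hSU).trans (by omega))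
    push Not at hall
    obtain ⟨i, hi⟩ := hall
    have hne : (U.filter (fun u => c u = i ∧ s(u, a) ∉ h)).Nonempty := by
      rw [← Finset.card_pos]
      have := hav i
      omega
    obtain ⟨u, hu⟩ := hne
    simp only [Finset.mem_filter] at hu
    obtain ⟨huU, hci, huh⟩ := hu
    have hua : u ≠ a := fun h => ha (h ▸ huU)
    have huS : u ∉ S := fun h' => huh (hSh u h')
    have hnext : ∀ b : Edge, Nonempty (FT G (insert s(u, a) m) (insert b.1 (insert s(u, a) h))) := by
      intro b
      apply ih (insert u S)
      · exact Finset.insert_subset huU hSU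
      · exact hm.trans (Finset.subset_insert _ _)
      · intro x hx
        rcases Finset.mem_insert.1 hx with rfl | hx
        · exact Finset.mem_insert_self _ _
        · exact Finset.mem_insert_of_mem (hSm x hx)
      · intro x hx
        rcases Finset.mem_insert.1 hx with rfl | hx
        · exact Finset.mem_insert_of_mem (Finset.mem_insert_self _ _)
        · exact Finset.mem_insert_of_mem (Finset.mem_insert_of_mem (hSh x hx))
      · intro j
        rw [Finset.filter_insert]
        split_ifs with hj
        · have hij : i = j := hci.symm.trans hj
          subst hij
          exact (Finset.card_insert_le _ _).trans hi
        · exact hle j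
      · rw [Finset.card_insert_of_notMem huS]
        omega
      · intro j
        have h1 := avail_insert c j a U h s(u, a)
        have h2 := avail_insert c j a U (insert s(u, a) h) b.1
        have := hav j
        omega
      · have h1 := touched_insert h U s(u, a)
        have h2 := touched_insert (insert s(u, a) h) U b.1
        omega
    exact ⟨FT.step m h ⟨s(u, a), by simpa using hua⟩ huh (fun b => (hnext b).some)⟩

/-- bound constants -/
def CC (k : ℕ) : ℕ → ℕ
  | 0 => 0
  | d + 1 => 4 * k * CC k d + 2 * k

open Classical in
/-- children of a node -/
noncomputable def kids (T : Finset (List ℕ)) (l : List ℕ) : Finset ℕ :=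
  (T.biUnion List.toFinset).filter (fun v => v :: l ∈ T)

lemma mem_kids {T : Finset (List ℕ)} {l : List ℕ} {v : ℕ} : v ∈ kids T l ↔ v :: l ∈ T := by
  classical
  simp only [kids, Finset.mem_filter, Finset.mem_biUnion, List.mem_toFinset, and_iff_right_iff_imp]
  intro h
  exact ⟨_, h, by simp⟩

/-- what Maker achieves in one phase -/
def ExtOK {k : ℕ} (c : ℕ → Fin k) (T : Finset (List ℕ)) (m : Finset (Sym2 ℕ)) (v : ℕ) (l : List ℕ) :
    Prop :=
  l ∈ T ∧ v :: l ∉ T ∧ (kids T l).card ≤ 2 * CC k l.length ∧ (c v : ℕ) = l.length % k ∧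
    ∀ x ∈ l, v ≠ x ∧ s(v, x) ∈ m

def Goal {k : ℕ} (c : ℕ → Fin k) (T : Finset (List ℕ)) (m : Finset (Sym2 ℕ)) : Prop :=
  ∃ v l, ExtOK c T m v l

lemma descend {k : ℕ} (hk : 1 ≤ k) (c : ℕ → Fin k) (T : Finset (List ℕ)) :
    ∀ (t : ℕ) (l : List ℕ) (U : Finset ℕ) (m h : Finset (Sym2 ℕ)), l ∈ T →
      (∀ x ∈ T, x.length ≤ l.length + t) →
      (∀ u ∈ U, ∀ x ∈ T, u ∉ x) →
      (∀ u ∈ U, ∀ x ∈ l, s(u, x) ∈ m) →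
      (∀ i, (4 * k) ^ t ≤ (U.filter (fun u => c u = i)).card) →
      touched h U ≤ CC k l.length * (4 * k) ^ t →
      Nonempty (FT (Goal c T) m h) := by
  classical
  intro t
  have finish : ∀ (t : ℕ) (l : List ℕ) (U : Finset ℕ) (m h : Finset (Sym2 ℕ)), l ∈ T →
      (∀ u ∈ U, ∀ x ∈ T, u ∉ x) →
      (∀ u ∈ U, ∀ x ∈ l, s(u, x) ∈ m) →
      (∀ i, (4 * k) ^ t ≤ (U.filter (fun u => c u = i)).card) →
      (kids T l).card ≤ 2 * CC k l.length → Nonempty (FT (Goal c T) m h) := by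
    intro t l U m h hl hU hUm hcol hkids
    have hpos : 0 < (4 * k) ^ t := by positivity
    have hlt : l.length % k < k := Nat.mod_lt _ hk
    obtain ⟨v, hv⟩ := Finset.card_pos.1 (hpos.trans_le (hcol ⟨l.length % k, hlt⟩))
    simp only [Finset.mem_filter] at hv
    obtain ⟨hvU, hcv⟩ := hv
    refine ⟨FT.done m h ⟨v, l, hl, fun hmem => hU v hvU _ hmem (by simp), hkids, by rw [hcv], ?_⟩⟩
    intro x hx
    exact ⟨fun hvx => hU v hvU l hl (hvx ▸ hx), hUm v hvU x hx⟩
  induction t with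
  | zero =>
    intro l U m h hl hlen hU hUm hcol ht
    refine finish 0 l U m h hl hU hUm hcol ?_
    have : kids T l = ∅ := by
      rw [Finset.eq_empty_iff_forall_notMem]
      intro v hv
      have := hlen _ (mem_kids.1 hv)
      simp at this
    simp [this]
  | succ t ih =>
    intro l U m h hl hlen hU hUm hcol ht
    by_cases hkids : (kids T l).card ≤ 2 * CC k l.length
    · exact finish (t+1) l U m h hl hU hUm hcol hkids
    push Not at hkids
    set n' := (4 * k) ^ t with hn'
    set C := CC k l.length with hC
    have hpow : (4 * k) ^ (t + 1) = 4 * k * n' := by rw [pow_succ, mul_comm]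
    rw [hpow] at ht hcol
    have hkU : ∀ a ∈ kids T l, a ∉ U := fun a ha haU =>
      hU a haU _ (mem_kids.1 ha) (by simp)
    -- find a good child
    have hgood : ∃ a ∈ kids T l, (U.filter (fun u => s(u, a) ∈ h)).card ≤ 2 * k * n' := by
      by_contra! hbad
      have h1 : ∑ a ∈ kids T l, (U.filter (fun u => s(u, a) ∈ h)).card ≤ touched h U := by
        rw [← Finset.card_sigma]
        unfold touched
        apply Finset.card_le_card_of_injOn (fun p => s(p.2, p.1))
        · rintro ⟨a, u⟩ hp
          simp only [Finset.coe_sigma, Set.mem_sigma_iff, Finset.mem_coe, Finset.mem_filter] at hp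
          simp only [Finset.coe_filter, Set.mem_ofPred_eq]
          exact ⟨hp.2.2, u, hp.2.1, by simp⟩
        · rintro ⟨a, u⟩ hp ⟨a', u'⟩ hp' heq
          simp only [Finset.coe_sigma, Set.mem_sigma_iff, Finset.mem_coe, Finset.mem_filter] at hp hp'
          simp only [Sym2.eq_iff] at heq
          rcases heq with ⟨rfl, rfl⟩ | ⟨rfl, rfl⟩
          · rfl
          · exact absurd hp.2.1 (hkU _ hp'.1)
      have h2 : (kids T l).card * (2 * k * n' + 1) ≤
          ∑ a ∈ kids T l, (U.filter (fun u => s(u, a) ∈ h)).card := by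
        rw [← smul_eq_mul]
        exact Finset.card_nsmul_le_sum _ _ _ (fun a ha => hbad a ha)
      have h3 : (2 * C + 1) * (2 * k * n' + 1) ≤ (kids T l).card * (2 * k * n' + 1) :=
        Nat.mul_le_mul_right _ hkids
      nlinarith
    obtain ⟨a, haK, haB⟩ := hgood
    refine phase c (Goal c T) m a U (hkU a haK) n' (CC k (l.length + 1) * n') ?_ (k * n') ∅ m h
      (Finset.empty_subset _) (Finset.Subset.refl _) (by simp) (by simp) (by simp) (by simp) ?_ ?_
    · intro S m' h' hSU hmm hSm hSc hSt
      refine ih (a :: l) S m' h' (mem_kids.1 haK) ?_ ?_ ?_ hSc (by simpa using hSt)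
      · intro x hx
        have := hlen x hx
        simp only [List.length_cons]
        omega
      · exact fun u hu => hU u (hSU hu)
      · intro u hu x hx
        rcases List.mem_cons.1 hx with rfl | hx
        · exact hSm u hu
        · exact hmm (hUm u (hSU hu) x hx)
    · intro i
      have h1 : (U.filter (fun u => c u = i)).card ≤
          (U.filter (fun u => c u = i ∧ s(u, a) ∉ h)).card + (U.filter (fun u => s(u, a) ∈ h)).card := by
        refine le_trans (Finset.card_le_card ?_) (Finset.card_union_le _ _)
        intro u
        simp only [Finset.mem_filter, Finset.mem_union]
        tauto
      have := hcol i
      nlinarith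
    · have : CC k (l.length + 1) = 4 * k * C + 2 * k := rfl
      rw [this]
      nlinarith

lemma exists_FT {k : ℕ} (hk : 1 ≤ k) (c : ℕ → Fin k) (hc : ∀ i : Fin k, (c ⁻¹' {i}).Infinite)
    (T : Finset (List ℕ)) (hT : [] ∈ T) (m h : Finset (Sym2 ℕ)) :
    Nonempty (FT (Goal c T) m h) := by
  classical
  set bad : Finset ℕ := T.biUnion List.toFinset ∪ h.biUnion Sym2.toFinset with hbad
  set D := T.sup List.length with hD
  have : ∀ i : Fin k, ∃ A : Finset ℕ, (A : Set ℕ) ⊆ c ⁻¹' {i} \ (bad : Set ℕ) ∧ A.card = (4 * k) ^ D :=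
    fun i => ((hc i).sdiff bad.finite_toSet).exists_subset_card_eq _
  choose A hA hAc using this
  have hUbad : ∀ u ∈ Finset.univ.biUnion A, u ∉ bad := by
    intro u hu
    simp only [Finset.mem_biUnion, Finset.mem_univ, true_and] at hu
    obtain ⟨i, hi⟩ := hu
    simpa using (hA i hi).2
  refine descend hk c T D [] (Finset.univ.biUnion A) m h hT ?_ ?_ (by simp) ?_ ?_
  · intro x hx
    simpa using Finset.le_sup (f := List.length) hx
  · intro u hu x hx hux
    apply hUbad u hu
    simp only [hbad, Finset.mem_union, Finset.mem_biUnion, List.mem_toFinset]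
    exact Or.inl ⟨x, hx, hux⟩
  · intro i
    rw [← hAc i]
    apply Finset.card_le_card
    intro u hu
    simp only [Finset.mem_filter, Finset.mem_biUnion, Finset.mem_univ, true_and]
    exact ⟨⟨i, hu⟩, (hA i hu).1⟩
  · have : touched h (Finset.univ.biUnion A) = 0 := by
      unfold touched
      rw [Finset.card_eq_zero, Finset.filter_eq_empty_iff]
      rintro e he ⟨u, hu, hue⟩
      apply hUbad u hu
      simp only [hbad, Finset.mem_union, Finset.mem_biUnion, Sym2.mem_toFinset]
      exact Or.inr ⟨e, he, hue⟩
    simp [this]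

lemma exists_fresh (h : Finset (Sym2 ℕ)) : ∃ e : Edge, e.1 ∉ h := by
  classical
  obtain ⟨v, hv⟩ := Infinite.exists_notMem_finset (insert 0 (h.biUnion Sym2.toFinset))
  simp only [Finset.mem_insert, Finset.mem_biUnion, Sym2.mem_toFinset, not_or, not_exists,
    not_and] at hv
  exact ⟨⟨s(v, 0), by simpa using hv.1⟩, fun hmem => hv.2 _ hmem (by simp)⟩

noncomputable def fresh (h : Finset (Sym2 ℕ)) : Edge := (exists_fresh h).choose

lemma fresh_spec (h : Finset (Sym2 ℕ)) : (fresh h).1 ∉ h := (exists_fresh h).choose_spec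

/-- the states of Maker's machine -/
structure QQ {k : ℕ} (c : ℕ → Fin k) where
  T : Finset (List ℕ)
  hT : [] ∈ T
  m : Finset (Sym2 ℕ)
  h : Finset (Sym2 ℕ)
  ft : FT (Goal c T) m h

noncomputable def ftMove {G : Finset (Sym2 ℕ) → Prop} {m h : Finset (Sym2 ℕ)} : FT G m h → Edge
  | .done _ h _ => fresh h
  | .step _ _ e _ _ => e

lemma ftMove_notMem {G : Finset (Sym2 ℕ) → Prop} {m h : Finset (Sym2 ℕ)} (f : FT G m h) :
    (ftMove f).1 ∉ h := by
  cases f with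
  | done _ _ _ => exact fresh_spec _
  | step _ _ e he _ => exact he

open Classical in
noncomputable def upd {k : ℕ} {c : ℕ → Fin k}
    (H : ∀ (T : Finset (List ℕ)), [] ∈ T → ∀ m h : Finset (Sym2 ℕ), Nonempty (FT (Goal c T) m h))
    (q : QQ c) (b : Edge) : QQ c :=
  match q with
  | ⟨T, hT, _, _, .done m h hg⟩ =>
    { T := insert (hg.choose :: hg.choose_spec.choose) T
      hT := Finset.mem_insert_of_mem hT
      m := insert (fresh h).1 m
      h := insert b.1 (insert (fresh h).1 h)
      ft := (H _ (Finset.mem_insert_of_mem hT) _ _).some }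
  | ⟨T, hT, _, _, .step m h e _ nx⟩ =>
    { T := T
      hT := hT
      m := insert e.1 m
      h := insert b.1 (insert e.1 h)
      ft := nx b }

section machine
variable {k : ℕ} {c : ℕ → Fin k}
  (H : ∀ (T : Finset (List ℕ)), [] ∈ T → ∀ m h : Finset (Sym2 ℕ), Nonempty (FT (Goal c T) m h))

open Classical in
lemma upd_m (q : QQ c) (b : Edge) : (upd H q b).m = insert (ftMove q.ft).1 q.m := by
  obtain ⟨T, hT, m, h, ft⟩ := q
  cases ft <;> rfl

open Classical in
lemma upd_h (q : QQ c) (b : Edge) :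
    (upd H q b).h = insert b.1 (insert (ftMove q.ft).1 q.h) := by
  obtain ⟨T, hT, m, h, ft⟩ := q
  cases ft <;> rfl

open Classical in
lemma upd_T (q : QQ c) (b : Edge) : (upd H q b).T = q.T ∨
    ∃ v l, ExtOK c q.T q.m v l ∧ (upd H q b).T = insert (v :: l) q.T := by
  obtain ⟨T, hT, m, h, ft⟩ := q
  cases ft with
  | done _ _ hg => exact Or.inr ⟨_, _, hg.choose_spec.choose_spec, rfl⟩
  | step => exact Or.inl rfl

/-- the run of the machine against Breaker's moves -/
noncomputable def runQ (B : ℕ → Edge) : ℕ → QQ c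
  | 0 => ⟨{[]}, by simp, ∅, ∅, (H _ (by simp) _ _).some⟩
  | n + 1 => upd H (runQ B n) (B n)

lemma runQ_T_mono (B : ℕ → Edge) : Monotone (fun n => (runQ H B n).T) := by
  classical
  apply monotone_nat_of_le_succ
  intro n
  rcases upd_T H (runQ H B n) (B n) with h | ⟨v, l, -, h⟩
  · exact h.symm.le
  · exact (Finset.subset_insert _ _).trans h.symm.le

lemma runQ_progress_aux (B : ℕ → Edge) (T : Finset (List ℕ)) (m h : Finset (Sym2 ℕ))
    (ft : FT (Goal c T) m h) : ∀ (hT : [] ∈ T) (n : ℕ), runQ H B n = ⟨T, hT, m, h, ft⟩ →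
      ∃ n', T.card < (runQ H B n').T.card := by
  classical
  induction ft with
  | done m h hg =>
    intro hT n hn
    refine ⟨n + 1, ?_⟩
    have : (runQ H B (n+1)).T = insert (hg.choose :: hg.choose_spec.choose) T := by
      show (upd H (runQ H B n) (B n)).T = _
      rw [hn]
      rfl
    rw [this, Finset.card_insert_of_notMem hg.choose_spec.choose_spec.2.1]
    omega
  | step m h e he nx ih =>
    intro hT n hn
    apply ih (B n) hT (n + 1)
    show upd H (runQ H B n) (B n) = _
    rw [hn]
    rfl

lemma runQ_unbounded (B : ℕ → Edge) (N : ℕ) : ∃ n, N ≤ (runQ H B n).T.card := by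
  induction N with
  | zero => exact ⟨0, by omega⟩
  | succ N ih =>
    obtain ⟨n, hn⟩ := ih
    obtain ⟨n', hn'⟩ := runQ_progress_aux H B _ _ _ (runQ H B n).ft (runQ H B n).hT n rfl
    exact ⟨n', by omega⟩

/-- node invariant -/
def NodeOK (c : ℕ → Fin k) (T : Finset (List ℕ)) (m : Finset (Sym2 ℕ)) : Prop :=
  (∀ v l, v :: l ∈ T → l ∈ T ∧ (c v : ℕ) = l.length % k ∧ ∀ x ∈ l, v ≠ x ∧ s(v, x) ∈ m) ∧
  ∀ l, (kids T l).card ≤ 2 * CC k l.length + 1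

lemma runQ_ok (B : ℕ → Edge) (n : ℕ) : NodeOK c (runQ H B n).T (runQ H B n).m := by
  classical
  induction n with
  | zero =>
    constructor
    · intro v l h
      simp [runQ] at h
    · intro l
      have : kids (runQ H B 0).T l = ∅ := by
        rw [Finset.eq_empty_iff_forall_notMem]
        intro v hv
        have := mem_kids.1 hv
        simp [runQ] at this
      simp [this]
  | succ n ih =>
    obtain ⟨ih1, ih2⟩ := ih
    have hm : (runQ H B n).m ⊆ (runQ H B (n+1)).m := by
      show _ ⊆ (upd H (runQ H B n) (B n)).m
      rw [upd_m]
      exact Finset.subset_insert _ _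
    rcases upd_T H (runQ H B n) (B n) with h | ⟨w, l', hE, h⟩
    · have h' : (runQ H B (n+1)).T = (runQ H B n).T := h
      unfold NodeOK
      rw [h']
      refine ⟨fun v l hv => ?_, ih2⟩
      obtain ⟨h1, h2, h3⟩ := ih1 v l hv
      exact ⟨h1, h2, fun x hx => ⟨(h3 x hx).1, hm (h3 x hx).2⟩⟩
    · have h' : (runQ H B (n+1)).T = insert (w :: l') (runQ H B n).T := h
      obtain ⟨e1, e2, e3, e4, e5⟩ := hE
      unfold NodeOK
      rw [h']
      refine ⟨fun v l hv => ?_, fun l => ?_⟩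
      · rcases Finset.mem_insert.1 hv with hv | hv
        · obtain ⟨rfl, rfl⟩ := List.cons.inj hv
          exact ⟨Finset.mem_insert_of_mem e1, e4, fun x hx => ⟨(e5 x hx).1, hm (e5 x hx).2⟩⟩
        · obtain ⟨h1, h2, h3⟩ := ih1 v l hv
          exact ⟨Finset.mem_insert_of_mem h1, h2, fun x hx => ⟨(h3 x hx).1, hm (h3 x hx).2⟩⟩
      · by_cases hl : l = l'
        · subst hl
          calc _ ≤ (insert w (kids (runQ H B n).T l)).card := by
                apply Finset.card_le_card
                intro v hv
                rcases Finset.mem_insert.1 (mem_kids.1 hv) with hv | hv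
                · simp [(List.cons.inj hv).1]
                · exact Finset.mem_insert_of_mem (mem_kids.2 hv)
            _ ≤ _ := (Finset.card_insert_le _ _).trans (by omega)
        · refine le_trans (Finset.card_le_card ?_) (ih2 l)
          intro v hv
          rcases Finset.mem_insert.1 (mem_kids.1 hv) with hv | hv
          · exact absurd (List.cons.inj hv).2 hl
          · exact mem_kids.2 hv

/-- parity fold computing the machine state from a history -/
noncomputable def foldQ (L : List Edge) : Bool × QQ c :=
  L.foldl (fun p e => if p.1 then (false, upd H p.2 e) else (true, p.2))
    (false, ⟨{[]}, by simp, ∅, ∅, (H _ (by simp) _ _).some⟩)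

lemma foldQ_hist (M B : ℕ → Edge) (n : ℕ) : foldQ H (histM M B n) = (false, runQ H B n) := by
  induction n with
  | zero => rfl
  | succ n ih =>
    unfold foldQ at ih ⊢
    rw [histM, List.foldl_append, ih]
    simp [runQ]

open Classical in
noncomputable def strat (L : List Edge) : Edge :=
  if ftMove (foldQ H L).2.ft ∈ L then fresh (L.map Subtype.val).toFinset
  else ftMove (foldQ H L).2.ft

lemma strat_valid : ValidStrat (strat H) := by
  classical
  intro L
  unfold strat
  split_ifs with h
  · intro hmem
    apply fresh_spec (L.map Subtype.val).toFinset
    rw [List.mem_toFinset]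
    exact List.mem_map_of_mem hmem
  · exact h

lemma strat_follow (M B : ℕ → Edge) (hF : FollowsMaker (strat H) M B) (n : ℕ) :
    (∀ e ∈ histM M B n, e.1 ∈ (runQ H B n).h) ∧
    (∀ e ∈ (runQ H B n).m, ∃ j, (M j).1 = e) := by
  classical
  induction n with
  | zero => simp [histM, runQ]
  | succ n ih =>
    obtain ⟨ih1, ih2⟩ := ih
    have hM : M n = ftMove (runQ H B n).ft := by
      rw [hF n, strat, foldQ_hist, if_neg]
      intro hmem
      exact ftMove_notMem _ (ih1 _ hmem)
    have hm : (runQ H B (n+1)).m = insert (M n).1 (runQ H B n).m := by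
      rw [hM]; exact upd_m H _ _
    have hh : (runQ H B (n+1)).h = insert (B n).1 (insert (M n).1 (runQ H B n).h) := by
      rw [hM]; exact upd_h H _ _
    rw [hm, hh]
    constructor
    · intro e he
      simp only [histM, List.mem_append, List.mem_cons, List.not_mem_nil, or_false] at he
      rcases he with he | rfl | rfl
      · exact Finset.mem_insert_of_mem (Finset.mem_insert_of_mem (ih1 e he))
      · exact Finset.mem_insert_of_mem (Finset.mem_insert_self _ _)
      · exact Finset.mem_insert_self _ _
    · intro e he
      rcases Finset.mem_insert.1 he with rfl | he
      · exact ⟨n, rfl⟩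
      · exact ih2 e he

end machine

/-- König's lemma for sets of lists closed under tails -/
lemma konig (X : Set (List ℕ)) (hX : X.Infinite) (hcl : ∀ v l, v :: l ∈ X → l ∈ X)
    (hfin : ∀ l, {v | v :: l ∈ X}.Finite) :
    ∃ r : ℕ → List ℕ, ∃ f : ℕ → ℕ, r 0 = [] ∧ (∀ n, r (n + 1) = f n :: r n) ∧ ∀ n, r n ∈ X := by
  classical
  have hsuf : ∀ l x : List ℕ, l <:+ x → x ∈ X → l ∈ X := by
    rintro l x ⟨p, rfl⟩ hx
    induction p with
    | nil => exact hx
    | cons a p ih => exact ih (hcl _ _ hx)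
  let Y := {l : List ℕ // {x ∈ X | l <:+ x}.Infinite}
  have step : ∀ l : Y, ∃ v, {x ∈ X | (v :: l.1) <:+ x}.Infinite := by
    rintro ⟨l, hl⟩
    by_contra! hcon
    apply hl
    refine ((Set.finite_singleton l).union ((hfin l).biUnion (t := fun v => {x ∈ X | (v :: l) <:+ x})
      (fun v _ => hcon v))).subset ?_
    rintro x ⟨hx, p, rfl⟩
    rcases List.eq_nil_or_concat p with rfl | ⟨p', a, rfl⟩
    · left; simp
    · right
      have hs : (a :: l) <:+ (p'.concat a) ++ l := ⟨p', by simp⟩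
      simp only [Set.mem_iUnion]
      exact ⟨a, hsuf _ _ hs hx, hx, hs⟩
  choose g hg using step
  let R : ℕ → Y := fun n => Nat.rec ⟨[], by simpa using hX⟩ (fun _ y => ⟨g y :: y.1, hg y⟩) n
  refine ⟨fun n => (R n).1, fun n => g (R n), rfl, fun n => rfl, fun n => ?_⟩
  obtain ⟨x, hx, hs⟩ := (R n).2.nonempty
  exact hsuf _ _ hs hx

/-- In the vertex-coloured game with finitely many colours (every colour class
infinite), Maker can build a K^{ℵ₀} using every colour class infinitely often. -/
theorem maker_wins_finitely_many_colours (k : ℕ) (hk : 1 ≤ k) (c : ℕ → Fin k)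
    (hc : ∀ i : Fin k, (c ⁻¹' {i}).Infinite) :
    ∃ σ : List Edge → Edge, ValidStrat σ ∧
      ∀ M B : ℕ → Edge, IsPlay M B → FollowsMaker σ M B →
        ∃ W : Set ℕ, W.Infinite ∧ BuildsClique M W ∧
          ∀ i : Fin k, (W ∩ c ⁻¹' {i}).Infinite := by
  classical
  have H := exists_FT hk c hc
  refine ⟨strat H, strat_valid H, fun M B _ hF => ?_⟩
  have hmono := runQ_T_mono H B
  let X : Set (List ℕ) := ⋃ n, ((runQ H B n).T : Set (List ℕ))
  have memX : ∀ x, x ∈ X ↔ ∃ n, x ∈ (runQ H B n).T := by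
    intro x
    simp [X]
  have node : ∀ v l, v :: l ∈ X → l ∈ X ∧ (c v : ℕ) = l.length % k ∧
      ∀ x ∈ l, v ≠ x ∧ ∃ j, (M j).1 = s(v, x) := by
    intro v l hv
    obtain ⟨n, hn⟩ := (memX _).1 hv
    obtain ⟨h1, h2, h3⟩ := (runQ_ok H B n).1 v l hn
    exact ⟨(memX _).2 ⟨n, h1⟩, h2, fun x hx =>
      ⟨(h3 x hx).1, (strat_follow H M B hF n).2 _ (h3 x hx).2⟩⟩
  have hXinf : X.Infinite := by
    intro hfin
    obtain ⟨n, hn⟩ := runQ_unbounded H B (hfin.toFinset.card + 1)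
    have : (runQ H B n).T.card ≤ hfin.toFinset.card := by
      apply Finset.card_le_card
      intro x hx
      rw [Set.Finite.mem_toFinset]
      exact (memX x).2 ⟨n, hx⟩
    omega
  have hbr : ∀ l, {v | v :: l ∈ X}.Finite := by
    intro l
    by_contra hinf
    obtain ⟨A, hA, hAc⟩ := Set.Infinite.exists_subset_card_eq hinf (2 * CC k l.length + 2)
    have : ∀ v : ℕ, ∃ n, v ∈ A → v :: l ∈ (runQ H B n).T := by
      intro v
      by_cases hv : v ∈ A
      · obtain ⟨n, hn⟩ := (memX _).1 (hA hv)
        exact ⟨n, fun _ => hn⟩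
      · exact ⟨0, fun h => absurd h hv⟩
    choose g hg using this
    have hle := (runQ_ok H B (A.sup g)).2 l
    have : A ⊆ kids (runQ H B (A.sup g)).T l := fun v hv =>
      mem_kids.2 (hmono (Finset.le_sup hv) (hg v hv))
    have := Finset.card_le_card this
    omega
  obtain ⟨r, f, hr0, hr, hrX⟩ := konig X hXinf (fun v l h => (node v l h).1) hbr
  have hlen : ∀ n, (r n).length = n := by
    intro n
    induction n with
    | zero => simp [hr0]
    | succ n ih => simp [hr, ih]
  have hmem : ∀ i j, i < j → f i ∈ r j := by
    intro i j hij
    induction j with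
    | zero => omega
    | succ j ih =>
      rw [hr]
      rcases Nat.lt_succ_iff_lt_or_eq.1 hij with h | rfl
      · exact List.mem_cons_of_mem _ (ih h)
      · simp
  have hnode : ∀ n, (c (f n) : ℕ) = n % k ∧
      ∀ x ∈ r n, f n ≠ x ∧ ∃ j, (M j).1 = s(f n, x) := by
    intro n
    have h := node (f n) (r n) (hr n ▸ hrX (n + 1))
    rw [hlen] at h
    exact h.2
  have hinj : Function.Injective f := by
    intro i j hij
    rcases lt_trichotomy i j with h | h | h
    · exact absurd hij.symm ((hnode j).2 _ (hmem i j h)).1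
    · exact h
    · exact absurd hij ((hnode i).2 _ (hmem j i h)).1
  refine ⟨Set.range f, Set.infinite_range_of_injective hinj, ?_, ?_⟩
  · rintro _ ⟨i, rfl⟩ _ ⟨j, rfl⟩ hne
    rcases lt_trichotomy i j with h | rfl | h
    · rw [Sym2.eq_swap]
      exact ((hnode j).2 _ (hmem i j h)).2
    · exact absurd rfl hne
    · exact ((hnode i).2 _ (hmem j i h)).2
  · intro i
    refine Set.infinite_of_injective_forall_mem (f := fun n : ℕ => f (n * k + i)) ?_ ?_
    · intro a b hab
      have := hinj hab
      have h2 : a * k = b * k := by omega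
      exact Nat.eq_of_mul_eq_mul_right hk h2
    · intro n
      refine ⟨⟨_, rfl⟩, ?_⟩
      apply Fin.ext
      rw [(hnode _).1, Nat.mul_add_mod_self_right]
      exact Nat.mod_eq_of_lt i.2
end

section
/- In the vertex-coloured game with infinitely many colours, Breaker can prevent Maker from using every colour: let c : ℕ → ℕ be a colouring of the vertices such that every colour class c⁻¹(i) is infinite. Then Breaker has a valid strategy such that in every play following it there is no infinite set W ⊆ ℕ with every edge having both endpoints in W among Maker's claimed edges and with W ∩ c⁻¹(i) ≠ ∅ for every colour i ∈ ℕ. -/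
def colF (c : ℕ → ℕ) (n : ℕ) : ℕ := n + 1 + ∑ w ∈ Finset.range (n + 1), c w

lemma colF_strictMono (c : ℕ → ℕ) : StrictMono (colF c) := by
  apply strictMono_nat_of_lt_succ
  intro n
  unfold colF
  rw [Finset.sum_range_succ _ (n + 1)]
  omega

lemma lt_of_colF {c : ℕ → ℕ} {w n : ℕ} (h : c w = colF c n) : n < w := by
  by_contra hle
  have hm : w ∈ Finset.range (n + 1) := by simp; omega
  have := Finset.single_le_sum (f := c) (fun i _ => Nat.zero_le _) hm
  unfold colF at h
  omega

def PRel (c : ℕ → ℕ) (e e' : Edge) : Prop :=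
  ∃ u v w : ℕ, u ≠ v ∧ c w = colF c (Nat.pair (min u v) (max u v)) ∧
    (e : Sym2 ℕ) = s(u, w) ∧ (e' : Sym2 ℕ) = s(v, w)

lemma lt_of_col {c : ℕ → ℕ} {u v w : ℕ}
    (h : c w = colF c (Nat.pair (min u v) (max u v))) : u < w ∧ v < w := by
  have h1 := lt_of_colF h
  have h2 := Nat.right_le_pair (min u v) (max u v)
  omega

lemma PRel_unique {c : ℕ → ℕ} {e a b : Edge} (h1 : PRel c e a) (h2 : PRel c e b) : a = b := by
  obtain ⟨u, v, w, huv, hc, he, ha⟩ := h1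
  obtain ⟨u', v', w', huv', hc', he', hb⟩ := h2
  have l1 := lt_of_col hc
  have l2 := lt_of_col hc'
  rw [he, Sym2.eq_iff] at he'
  have hh : u = u' ∧ w = w' := by omega
  obtain ⟨rfl, rfl⟩ := hh
  have hp := (colF_strictMono c).injective (hc.symm.trans hc')
  rw [Nat.pair_eq_pair] at hp
  have : v = v' := by omega
  subst this
  exact Subtype.ext (ha.trans hb.symm)

lemma edge_fresh (h : List Edge) : ∃ e : Edge, e ∉ h := by
  have : Infinite Edge := by
    refine Infinite.of_injective (fun n : ℕ => (⟨s(0, n + 1), by simp⟩ : Edge)) ?_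
    intro a b hab
    have := congrArg Subtype.val hab
    simp only [Sym2.eq_iff] at this
    omega
  obtain ⟨e, he⟩ := Set.Infinite.exists_notMem_finset (Set.infinite_univ (α := Edge))
    (by classical exact h.toFinset)
  exact ⟨e, by simpa using he.2⟩

lemma mem_histM {M B : ℕ → Edge} {x : Edge} (n : ℕ) (h : x ∈ histM M B n) :
    ∃ k < n, x = M k ∨ x = B k := by
  induction n with
  | zero => simp [histM] at h
  | succ n ih =>
    simp only [histM, List.mem_append, List.mem_cons, List.not_mem_nil, or_false] at h
    rcases h with h | h
    · obtain ⟨k, hk, h⟩ := ih h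
      exact ⟨k, by omega, h⟩
    · exact ⟨n, by omega, h⟩

lemma play_MB {M B : ℕ → Edge} (hp : IsPlay M B) (m k : ℕ) : M m ≠ B k := by
  intro h
  have : interleave M B (2 * m) = interleave M B (2 * k + 1) := by
    have e1 : (2 * k + 1) / 2 = k := by omega
    have e2 : (2 * k + 1) % 2 = 1 := by omega
    simp [interleave, e1, e2, h]
  have := hp this
  omega

lemma play_MM {M B : ℕ → Edge} (hp : IsPlay M B) {m k : ℕ} (h : M m = M k) : m = k := by
  have : interleave M B (2 * m) = interleave M B (2 * k) := by
    simp [interleave, h]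
  have := hp this
  omega

/-- In the vertex-coloured game with infinitely many colours (every colour class
infinite), Breaker can prevent Maker from building a K^{ℵ₀} meeting every
colour class. -/
theorem breaker_wins_all_colours (c : ℕ → ℕ) (hc : ∀ i : ℕ, (c ⁻¹' {i}).Infinite) :
    ∃ τ : List Edge → Edge, ValidStrat τ ∧
      ∀ M B : ℕ → Edge, IsPlay M B → FollowsBreaker τ M B →
        ¬ ∃ W : Set ℕ, W.Infinite ∧ BuildsClique M W ∧
            ∀ i : ℕ, (W ∩ c ⁻¹' {i}).Nonempty := by
  classical
  have key : ∀ h : List Edge, ∃ e' : Edge, e' ∉ h ∧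
      ∀ (l : List Edge) (a b : Edge), h = l ++ [a] → PRel c a b → b ∉ h → e' = b := by
    intro h
    by_cases hex : ∃ (l : List Edge) (a b : Edge), h = l ++ [a] ∧ PRel c a b ∧ b ∉ h
    · obtain ⟨l, a, b, rfl, hr, hb⟩ := hex
      refine ⟨b, hb, ?_⟩
      intro l' a' b' hl hr' _
      have := (List.append_inj' hl rfl).2
      simp only [List.cons.injEq, and_true] at this
      subst this
      exact PRel_unique hr hr'
    · obtain ⟨e, he⟩ := edge_fresh h
      exact ⟨e, he, fun l a b h1 h2 h3 => (hex ⟨l, a, b, h1, h2, h3⟩).elim⟩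
  choose τ hτ hτ' using key
  refine ⟨τ, hτ, ?_⟩
  rintro M B hp hf ⟨W, hW, hcl, hcol⟩
  have main : ∀ n m, n < m → ¬ PRel c (M n) (M m) := by
    intro n m hnm hr
    have hnot : M m ∉ histB M B n := by
      intro hmem
      simp only [histB, List.mem_append, List.mem_singleton] at hmem
      rcases hmem with hmem | hmem
      · obtain ⟨k, hk, h | h⟩ := mem_histM n hmem
        · have := play_MM hp h
          omega
        · exact play_MB hp _ _ h
      · have := play_MM hp hmem
        omega
    have := hτ' _ _ _ _ rfl hr hnot
    exact play_MB hp m n (this.symm.trans (hf n).symm)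
  obtain ⟨u, hu, v, hv, huv⟩ := hW.nontrivial
  obtain ⟨w, hw, hwc⟩ := hcol (colF c (Nat.pair (min u v) (max u v)))
  have hwc' : c w = colF c (Nat.pair (min u v) (max u v)) := hwc
  have hlt := lt_of_col hwc'
  obtain ⟨n, hn⟩ := hcl u hu w hw (by omega)
  obtain ⟨m, hm⟩ := hcl v hv w hw (by omega)
  rcases lt_trichotomy n m with h | h | h
  · exact main n m h ⟨u, v, w, huv, hwc', hn, hm⟩
  · subst h
    rw [hn, Sym2.eq_iff] at hm
    omega
  · exact main m n h ⟨v, u, w, huv.symm, by rw [min_comm, max_comm]; exact hwc', hm, hn⟩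
end

section
/- Disjointness of the pairing in Breaker's strategy: let c : ℕ → ℕ be a vertex colouring, e : ℕ → E an enumeration of the edges with e_i = {x_i, y_i}, and (c_i) a sequence of colours satisfying: c_i ≠ c_j for all j < i, and c_i ∉ c({x_j, y_j : j ≤ i}). For each i ∈ ℕ and each vertex v with c(v) = c_i, define the pair p(i,v) = { {v,x_i}, {v,y_i} } of edges. Then every such pair consists of two distinct edges, and any two pairs p(i,v), p(i',v') with (i,v) ≠ (i',v') are disjoint as sets of edges. -/
/-- Disjointness of the pairing in Breaker's strategy: the pairs
p(i,v) = { {v,xᵢ}, {v,yᵢ} } (for v of colour cᵢ) each consist of two distinct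
edges, and any two distinct pairs are disjoint. -/
theorem pairing_pairs_disjoint (c : ℕ → ℕ) (e : ℕ → Edge)
    (he : Function.Bijective e) (x y : ℕ → ℕ)
    (hxy : ∀ i, (e i : Sym2 ℕ) = s(x i, y i))
    (cs : ℕ → ℕ)
    (hcs_inj : ∀ i j, j < i → cs i ≠ cs j)
    (hcs_new : ∀ i j, j ≤ i → cs i ≠ c (x j) ∧ cs i ≠ c (y j)) :
    (∀ i v, c v = cs i → s(v, x i) ≠ s(v, y i)) ∧
    (∀ i v i' v', c v = cs i → c v' = cs i' → (i, v) ≠ (i', v') →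
      Disjoint ({s(v, x i), s(v, y i)} : Set (Sym2 ℕ))
        ({s(v', x i'), s(v', y i')} : Set (Sym2 ℕ))) := by
  have inj : ∀ i j, cs i = cs j → i = j := by
    intro i j h
    rcases lt_trichotomy i j with h1 | h1 | h1
    · exact absurd h.symm (hcs_inj j i h1)
    · exact h1
    · exact absurd h (hcs_inj i j h1)
  have key : ∀ i v i' v' a a', c v = cs i → c v' = cs i' → (i, v) ≠ (i', v') →
      (a = x i ∨ a = y i) → (a' = x i' ∨ a' = y i') → s(v, a) ≠ s(v', a') := by
    intro i v i' v' a a' hv hv' hne ha ha' h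
    rcases Sym2.eq_iff.mp h with ⟨h1, h2⟩ | ⟨h1, h2⟩
    · subst h1
      exact hne (by rw [inj i i' (hv.symm.trans hv')])
    · subst h1 h2
      rcases le_total i i' with hl | hl
      · have := hcs_new i' i hl
        rcases ha with h | h <;> rw [h] at hv' <;> simp_all
      · have := hcs_new i i' hl
        rcases ha' with h | h <;> rw [h] at hv <;> simp_all
  refine ⟨?_, ?_⟩
  · intro i v _ h
    have h1 : x i = y i := Sym2.congr_right.mp h
    apply (e i).2
    rw [hxy i, h1]
    simp
  · intro i v i' v' hv hv' hne
    rw [Set.disjoint_left]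
    rintro z (rfl | rfl) (h | h)
    · exact key i v i' v' _ _ hv hv' hne (Or.inl rfl) (Or.inl rfl) h
    · exact key i v i' v' _ _ hv hv' hne (Or.inl rfl) (Or.inr rfl) h
    · exact key i v i' v' _ _ hv hv' hne (Or.inr rfl) (Or.inl rfl) h
    · exact key i v i' v' _ _ hv hv' hne (Or.inr rfl) (Or.inr rfl) h
end

section
/- Blocking lemma for the pairing: let c : ℕ → ℕ be a vertex colouring, e : ℕ → E an enumeration of the edges with e_i = {x_i, y_i}, and (c_i) a sequence of colours with c_i ≠ c_j for j < i and c_i ∉ c({x_j, y_j : j ≤ i}). Suppose A ⊆ E is a set of edges that, for every i and every vertex v with c(v) = c_i, contains at most one of the two edges {v,x_i}, {v,y_i}. Then for every set W ⊆ ℕ such that every edge with both endpoints in W lies in A, and for every index i with x_i ∈ W and y_i ∈ W, the intersection W ∩ c⁻¹(c_i) is empty. -/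
/-- Blocking lemma for the pairing: if a set A of edges contains at most one
edge of each pair { {v,xᵢ}, {v,yᵢ} } (for v of colour cᵢ), then any vertex set
W all of whose internal edges lie in A and which contains both endpoints of
the i-th edge avoids the colour class of cᵢ entirely. -/
theorem pairing_blocking_lemma (c : ℕ → ℕ) (e : ℕ → Edge)
    (he : Function.Bijective e) (x y : ℕ → ℕ)
    (hxy : ∀ i, (e i : Sym2 ℕ) = s(x i, y i))
    (cs : ℕ → ℕ)
    (hcs_inj : ∀ i j, j < i → cs i ≠ cs j)
    (hcs_new : ∀ i j, j ≤ i → cs i ≠ c (x j) ∧ cs i ≠ c (y j))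
    (A : Set (Sym2 ℕ))
    (hA : ∀ i v, c v = cs i → ¬ (s(v, x i) ∈ A ∧ s(v, y i) ∈ A)) :
    ∀ W : Set ℕ, (∀ u ∈ W, ∀ w ∈ W, u ≠ w → s(u, w) ∈ A) →
      ∀ i, x i ∈ W → y i ∈ W → W ∩ c ⁻¹' {cs i} = ∅ := by
  intro W hW i hx hy
  refine Set.eq_empty_iff_forall_notMem.mpr ?_
  rintro v ⟨hv, hc⟩
  have hc' : c v = cs i := hc
  obtain ⟨h1, h2⟩ := hcs_new i i le_rfl
  refine hA i v hc' ⟨hW v hv _ hx ?_, hW v hv _ hy ?_⟩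
  · intro h
    exact h1 (by rw [← h, hc'])
  · intro h
    exact h2 (by rw [← h, hc'])
end

section
/- Combinatorial core of Breaker's win with infinitely many colours: let c : ℕ → ℕ be a vertex colouring with every colour class infinite, e : ℕ → E an enumeration of the edges with e_i = {x_i, y_i}, and (c_i) a sequence of colours with c_i ≠ c_j for j < i and c_i ∉ c({x_j, y_j : j ≤ i}). Suppose A ⊆ E is a set of edges that, for every i and every vertex v with c(v) = c_i, contains at most one of the two edges {v,x_i}, {v,y_i}. Then for every infinite set W ⊆ ℕ such that every edge with both endpoints in W lies in A, the set of colours i ∈ ℕ with W ∩ c⁻¹(i) = ∅ is infinite. -/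
/-- Combinatorial core of Breaker's win with infinitely many colours: if a set
A of edges contains at most one edge of each pair { {v,xᵢ}, {v,yᵢ} } (for v of
colour cᵢ), then every infinite vertex set W all of whose internal edges lie
in A completely avoids infinitely many colour classes. -/
theorem pairing_core_infinitely_many_missed_colours (c : ℕ → ℕ)
    (hc : ∀ i : ℕ, (c ⁻¹' {i}).Infinite) (e : ℕ → Edge)
    (he : Function.Bijective e) (x y : ℕ → ℕ)
    (hxy : ∀ i, (e i : Sym2 ℕ) = s(x i, y i))
    (cs : ℕ → ℕ)
    (hcs_inj : ∀ i j, j < i → cs i ≠ cs j)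
    (hcs_new : ∀ i j, j ≤ i → cs i ≠ c (x j) ∧ cs i ≠ c (y j))
    (A : Set (Sym2 ℕ))
    (hA : ∀ i v, c v = cs i → ¬ (s(v, x i) ∈ A ∧ s(v, y i) ∈ A)) :
    ∀ W : Set ℕ, W.Infinite → (∀ u ∈ W, ∀ w ∈ W, u ≠ w → s(u, w) ∈ A) →
      {i : ℕ | W ∩ c ⁻¹' {i} = ∅}.Infinite := by
  intro W hW hWA
  obtain ⟨a, ha⟩ := hW.nonempty
  have hinj : Function.Injective cs := by
    intro i j hij
    rcases lt_trichotomy i j with h | h | h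
    · exact absurd hij.symm (hcs_inj j i h)
    · exact h
    · exact absurd hij (hcs_inj i j h)
  have hex : ∀ w : ℕ, ∃ i, w ≠ a → (e i : Sym2 ℕ) = s(a, w) := by
    intro w
    by_cases hw : w = a
    · exact ⟨0, fun h => absurd hw h⟩
    · obtain ⟨i, hi⟩ := he.2 ⟨s(a, w), by simpa using fun h => hw h.symm⟩
      exact ⟨i, fun _ => by rw [hi]⟩
  choose g hg using hex
  have hW' : (W \ {a}).Infinite := hW.diff (Set.finite_singleton a)
  have hginj : Set.InjOn g (W \ {a}) := by
    intro u hu w hw h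
    have h1 := hg u hu.2
    have h2 := hg w hw.2
    rw [h, h2] at h1
    exact (Sym2.congr_right.1 h1).symm
  have hI := (hW'.image hginj).image (hinj.injOn)
  refine hI.mono ?_
  rintro _ ⟨_, ⟨w, hw, rfl⟩, rfl⟩
  have h1 := hg w hw.2
  rw [hxy] at h1
  have hm : x (g w) ∈ W ∧ y (g w) ∈ W := by
    rcases Sym2.eq_iff.1 h1 with ⟨p, q⟩ | ⟨p, q⟩
    · rw [p, q]; exact ⟨ha, hw.1⟩
    · rw [p, q]; exact ⟨hw.1, ha⟩
  rw [Set.mem_setOf_eq, Set.eq_empty_iff_forall_notMem]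
  rintro v ⟨hv, hcv⟩
  have hcv' : c v = cs (g w) := hcv
  have hn := hcs_new (g w) (g w) le_rfl
  refine hA (g w) v hcv' ⟨hWA v hv _ hm.1 ?_, hWA v hv _ hm.2 ?_⟩
  · intro h; exact hn.1 (by rw [← h, hcv'])
  · intro h; exact hn.2 (by rw [← h, hcv'])
end
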